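/- arXiv:2407.06609 — 2 statements merged into one kernel-verified Lean document; each statement's English description precedes it below -/
import Mathlib

section
/- Let a > 0 and ρ > 0. Define, for complex s with Re s > 1, Z_K(s) = 2·∑_{m,n=1}^∞ (4π²m²/a² + n²/ρ²)^{-s} + 2·∑_{m=1}^∞ (4π²m²/a²)^{-s} + ∑_{m=1}^∞ (m²/ρ²)^{-s} + 2·∑_{m,n=1}^∞ (4π²(m - 1/2)²/a² + n²/ρ²)^{-s}. Then there exists a function f : ℂ → ℂ, complex-differentiable at every point s ≠ 1, with f(s) = Z_K(s) for all s with Re s > 1, and -f'(0) = 2·log(2πρ) - 2π²ρ/(3a) + 4·∑_{k=1}^∞ log(1 - exp(-4π²ρk/a)) + 2·∑_{k=1}^∞ log(1 + 2/(exp(ak/ρ) - 1)). -/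
open Real

namespace KleinBottle

open Complex Filter Topology MeasureTheory Set Asymptotics HurwitzZeta

/-- The sum `∑_{n ≥ 1} exp (-π n² x)` for `x > 0`. -/
noncomputable def thetaTail (x : ℝ) : ℝ := (evenKernel 0 x - 1) / 2

lemma hasSum_thetaTail {x : ℝ} (hx : 0 < x) :
    HasSum (fun n : ℕ ↦ Real.exp (-π * ((n : ℝ) + 1) ^ 2 * x)) (thetaTail x) := by
  have h := (hasSum_nat_cosKernel₀ 0 hx).div_const 2
  rw [thetaTail, evenKernel_eq_cosKernel_of_zero]
  simpa using h

lemma continuousOn_thetaTail : ContinuousOn thetaTail (Ioi 0) :=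
  ((continuousOn_evenKernel 0).sub continuousOn_const).div_const 2

lemma thetaTail_functional_equation {x : ℝ} (hx : 0 < x) :
    2 * thetaTail x + 1 = x ^ (-(1 / 2) : ℝ) * (2 * thetaTail x⁻¹ + 1) := by
  have h := evenKernel_functional_equation 0 x
  rw [← evenKernel_eq_cosKernel_of_zero] at h
  rw [Real.rpow_neg hx.le, thetaTail, thetaTail]
  simp only [one_div] at h ⊢
  linear_combination h

lemma thetaTail_isBigO_atTop :
    ∃ p : ℝ, 0 < p ∧ thetaTail =O[atTop] fun x ↦ Real.exp (-p * x) := by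
  obtain ⟨p, hp, h⟩ := isBigO_atTop_evenKernel_sub 0
  refine ⟨p, hp, (h.const_mul_left (1 / 2)).congr_left fun x ↦ ?_⟩
  simp [thetaTail]
  ring

lemma thetaTail_isBigO_one : thetaTail =O[atTop] fun _ ↦ (1 : ℝ) := by
  obtain ⟨p, hp, h⟩ := thetaTail_isBigO_atTop
  refine h.trans (IsBigO.of_bound 1 ?_)
  filter_upwards [eventually_ge_atTop 0] with x hx
  simp only [norm_one, mul_one, Real.norm_eq_abs, Real.abs_exp, Real.exp_le_one_iff]
  nlinarith

lemma tendsto_const_mul_nhdsGT_zero {a : ℝ} (ha : 0 < a) :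
    Tendsto (fun t : ℝ ↦ a * t) (𝓝[>] 0) (𝓝[>] 0) := by
  refine tendsto_nhdsWithin_iff.mpr ⟨?_, ?_⟩
  · have : Tendsto (fun t : ℝ ↦ a * t) (𝓝 0) (𝓝 (a * 0)) := tendsto_id.const_mul a
    rw [mul_zero] at this
    exact this.mono_left nhdsWithin_le_nhds
  · filter_upwards [self_mem_nhdsWithin] with t ht
    exact mul_pos ha ht

lemma thetaTail_isBigO_zero :
    thetaTail =O[𝓝[>] 0] fun x ↦ x ^ (-(1 / 2) : ℝ) := by
  have h1 : (fun x : ℝ ↦ 2 * thetaTail x⁻¹ + 1) =O[𝓝[>] 0] fun _ ↦ (1 : ℝ) :=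
    ((thetaTail_isBigO_one.comp_tendsto tendsto_inv_nhdsGT_zero).const_mul_left 2).add
      (isBigO_refl _ _)
  have h2 : (fun _ : ℝ ↦ (1 : ℝ)) =O[𝓝[>] 0] fun x : ℝ ↦ x ^ (-(1 / 2) : ℝ) := by
    refine IsBigO.of_bound 1 ?_
    filter_upwards [Ioc_mem_nhdsGT (zero_lt_one' ℝ)] with x hx
    rw [norm_one, one_mul, Real.norm_of_nonneg (by have := hx.1; positivity)]
    exact Real.one_le_rpow_of_pos_of_le_one_of_nonpos hx.1 hx.2 (by norm_num)
  have h3 := (isBigO_refl (fun x : ℝ ↦ x ^ (-(1 / 2) : ℝ)) (𝓝[>] 0)).mul h1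
  simp only [mul_one] at h3
  refine ((h3.sub h2).const_mul_left (1 / 2)).congr' ?_ EventuallyEq.rfl
  filter_upwards [self_mem_nhdsWithin] with x hx
  rw [← thetaTail_functional_equation hx]
  ring

/-- The exponentially small part of `2 θ(At) θ(Ct)`, where `θ` is `thetaTail`. -/
noncomputable def thetaProd (A C t : ℝ) : ℂ :=
  ((C ^ (-(1 / 2) : ℝ) * t ^ (-(1 / 2) : ℝ) * thetaTail (A * t) *
    (2 * thetaTail (C * t)⁻¹) : ℝ) : ℂ)

lemma two_mul_thetaTail_mul {A C t : ℝ} (hC : 0 < C) (ht : 0 < t) :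
    2 * ((thetaTail (A * t) * thetaTail (C * t) : ℝ) : ℂ) =
      (C : ℂ) ^ (-(1 / 2) : ℂ) • ((t : ℂ) ^ (-(1 / 2) : ℂ) • (thetaTail (A * t) : ℂ)) -
        (thetaTail (A * t) : ℂ) + thetaProd A C t := by
  have h := thetaTail_functional_equation (mul_pos hC ht)
  rw [Real.mul_rpow hC.le ht.le] at h
  have e (x : ℝ) (hx : 0 < x) : (x : ℂ) ^ (-(1 / 2) : ℂ) = ((x ^ (-(1 / 2) : ℝ) : ℝ) : ℂ) := by
    rw [ofReal_cpow hx.le]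
    norm_num
  rw [e C hC, e t ht, thetaProd]
  simp only [smul_eq_mul]
  norm_cast
  linear_combination thetaTail (A * t) * h

lemma continuousOn_thetaTail_const_mul {A : ℝ} (hA : 0 < A) :
    ContinuousOn (fun t ↦ thetaTail (A * t)) (Ioi 0) :=
  continuousOn_thetaTail.comp (by fun_prop) fun _ ht ↦ mul_pos hA ht

lemma continuousOn_thetaProd {A C : ℝ} (hA : 0 < A) (hC : 0 < C) :
    ContinuousOn (thetaProd A C) (Ioi 0) := by
  refine Complex.continuous_ofReal.comp_continuousOn ?_
  refine ((continuousOn_const.mul ?_).mul (continuousOn_thetaTail_const_mul hA)).mul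
    (continuousOn_const.mul ?_)
  · exact continuousOn_id.rpow_const fun x hx ↦ Or.inl (ne_of_gt hx)
  · refine continuousOn_thetaTail.comp ?_ fun t ht ↦ inv_pos.mpr (mul_pos hC ht)
    exact ContinuousOn.inv₀ (by fun_prop) fun t ht ↦ (mul_pos hC ht).ne'

lemma thetaTail_const_mul_isBigO_zero {A : ℝ} (hA : 0 < A) :
    (fun t ↦ thetaTail (A * t)) =O[𝓝[>] 0] fun t ↦ t ^ (-(1 / 2) : ℝ) := by
  refine ((thetaTail_isBigO_zero.comp_tendsto (tendsto_const_mul_nhdsGT_zero hA)).congr'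
    EventuallyEq.rfl ?_).trans (isBigO_const_mul_self (A ^ (-(1 / 2) : ℝ)) _ _)
  filter_upwards [self_mem_nhdsWithin] with t ht
  exact Real.mul_rpow hA.le (le_of_lt ht)

lemma thetaTail_const_mul_isBigO_atTop {A : ℝ} (hA : 0 < A) :
    ∃ p : ℝ, 0 < p ∧ (fun t ↦ thetaTail (A * t)) =O[atTop] fun t ↦ Real.exp (-p * t) := by
  obtain ⟨p, hp, h⟩ := thetaTail_isBigO_atTop
  refine ⟨p * A, mul_pos hp hA, (h.comp_tendsto (tendsto_id.const_mul_atTop hA)).congr_right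
    fun t ↦ ?_⟩
  simp [mul_assoc]

lemma thetaProd_isBigO_atTop {A C : ℝ} (hA : 0 < A) (hC : 0 < C) :
    ∃ p : ℝ, 0 < p ∧ thetaProd A C =O[atTop] fun t ↦ Real.exp (-p * t) := by
  obtain ⟨p, hp, h⟩ := thetaTail_const_mul_isBigO_atTop hA
  refine ⟨p, hp, ?_⟩
  have h1 : (fun t : ℝ ↦ thetaTail (C * t)⁻¹) =O[atTop] fun t ↦ t ^ (1 / 2 : ℝ) := by
    have h2 := (thetaTail_const_mul_isBigO_zero (inv_pos.mpr hC)).comp_tendsto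
      tendsto_inv_atTop_nhdsGT_zero
    refine h2.congr' ?_ ?_
    · filter_upwards with t
      simp [mul_comm]
    · filter_upwards [eventually_gt_atTop 0] with t ht
      simp [Real.inv_rpow ht.le, Real.rpow_neg ht.le]
  have h3 := (((isBigO_refl (fun t : ℝ ↦ t ^ (-(1 / 2) : ℝ)) atTop).const_mul_left
    (C ^ (-(1 / 2) : ℝ))).mul h).mul (h1.const_mul_left 2)
  refine (isBigO_ofReal_left.mpr h3).congr' EventuallyEq.rfl ?_
  filter_upwards [eventually_gt_atTop 0] with t ht
  rw [mul_right_comm, ← Real.rpow_add ht]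
  norm_num

lemma thetaProd_isBigO_zero {A C : ℝ} (hA : 0 < A) (hC : 0 < C) (b : ℝ) :
    thetaProd A C =O[𝓝[>] 0] fun t ↦ t ^ (-b) := by
  have h1 : (fun t : ℝ ↦ thetaTail (C * t)⁻¹) =O[𝓝[>] 0] fun t ↦ t ^ (1 - b) := by
    obtain ⟨p, hp, h⟩ := thetaTail_const_mul_isBigO_atTop (inv_pos.mpr hC)
    have h2 := (h.trans (isLittleO_exp_neg_mul_rpow_atTop hp (b - 1)).isBigO).comp_tendsto
      tendsto_inv_nhdsGT_zero
    refine h2.congr' ?_ ?_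
    · filter_upwards with t
      simp [mul_comm]
    · filter_upwards [self_mem_nhdsWithin] with t ht
      simp only [Function.comp_apply]
      rw [Real.inv_rpow (le_of_lt ht), ← Real.rpow_neg (le_of_lt ht), neg_sub]
  have h3 := (((isBigO_refl (fun t : ℝ ↦ t ^ (-(1 / 2) : ℝ)) (𝓝[>] 0)).const_mul_left
    (C ^ (-(1 / 2) : ℝ))).mul (thetaTail_const_mul_isBigO_zero hA)).mul (h1.const_mul_left 2)
  refine (isBigO_ofReal_left.mpr h3).congr' EventuallyEq.rfl ?_
  filter_upwards [self_mem_nhdsWithin] with t ht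
  rw [← Real.rpow_add ht, ← Real.rpow_add ht]
  congr 1
  ring

lemma differentiable_mellin_thetaProd {A C : ℝ} (hA : 0 < A) (hC : 0 < C) :
    Differentiable ℂ (mellin (thetaProd A C)) := fun s ↦ by
  obtain ⟨p, hp, h⟩ := thetaProd_isBigO_atTop hA hC
  exact mellin_differentiableAt_of_isBigO_rpow_exp hp
    ((continuousOn_thetaProd hA hC).locallyIntegrableOn measurableSet_Ioi) h
    (thetaProd_isBigO_zero hA hC (s.re - 1)) (by linarith)

lemma mellinConvergent_thetaProd {A C : ℝ} (hA : 0 < A) (hC : 0 < C) (s : ℂ) :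
    MellinConvergent (thetaProd A C) s := by
  obtain ⟨p, hp, h⟩ := thetaProd_isBigO_atTop hA hC
  exact mellinConvergent_of_isBigO_rpow_exp hp
    ((continuousOn_thetaProd hA hC).locallyIntegrableOn measurableSet_Ioi) h
    (thetaProd_isBigO_zero hA hC (s.re - 1)) (by linarith)

lemma mellinConvergent_thetaTail {A : ℝ} (hA : 0 < A) {s : ℂ} (hs : 1 / 2 < s.re) :
    MellinConvergent (fun t ↦ (thetaTail (A * t) : ℂ)) s := by
  obtain ⟨p, hp, h⟩ := thetaTail_const_mul_isBigO_atTop hA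
  exact mellinConvergent_of_isBigO_rpow_exp hp
    ((Complex.continuous_ofReal.comp_continuousOn
      (continuousOn_thetaTail_const_mul hA)).locallyIntegrableOn measurableSet_Ioi)
    (isBigO_ofReal_left.mpr h)
    (isBigO_ofReal_left.mpr (thetaTail_const_mul_isBigO_zero hA)) hs

lemma mellin_thetaTail {A : ℝ} (hA : 0 < A) {s : ℂ} (hs : 1 / 2 < s.re) :
    mellin (fun t ↦ (thetaTail (A * t) : ℂ)) s =
      (A : ℂ) ^ (-s) * completedRiemannZeta (2 * s) := by
  have hs' : 1 < (2 * s).re := by simp; linarith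
  rw [mellin_comp_mul_left (fun t ↦ (thetaTail t : ℂ)) s hA, smul_eq_mul]
  congr 1
  have h := hasSum_mellin_pi_mul_sq (a := fun _ : ℕ ↦ (1 : ℂ)) (r := fun n : ℕ ↦ (n : ℝ) + 1)
    (F := fun t ↦ (thetaTail t : ℂ)) (s := 2 * s) (by linarith) (fun t ht ↦ ?_) ?_
  · rw [mul_div_cancel_left₀ _ (two_ne_zero' ℂ)] at h
    rw [← h.tsum_eq, completedZeta_eq_tsum_of_one_lt_re hs', ← zeta_eq_tsum_one_div_nat_cpow hs',
      zeta_eq_tsum_one_div_nat_add_one_cpow hs', ← Gammaℝ_def, ← tsum_mul_left]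
    refine tsum_congr fun n ↦ ?_
    rw [abs_of_pos (by positivity)]
    push_cast
    ring
  · have h0 (n : ℕ) : (n : ℝ) + 1 ≠ 0 := by positivity
    simp only [h0, if_false, one_mul]
    exact_mod_cast hasSum_thetaTail ht
  · have := (summable_nat_add_iff 1).mpr (Real.summable_one_div_nat_rpow.mpr hs')
    refine this.congr fun n ↦ ?_
    rw [abs_of_pos (by positivity)]
    simp

lemma summable_rpow_quadratic {A C : ℝ} (hA : 0 < A) (hC : 0 < C) {σ : ℝ} (hσ : 1 < σ) :
    Summable fun p : ℕ × ℕ ↦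
      (A * ((p.1 : ℝ) + 1) ^ 2 + C * ((p.2 : ℝ) + 1) ^ 2) ^ (-σ) := by
  have h1 : Summable fun n : ℕ ↦ ((n : ℝ) + 1) ^ (-σ) := by
    simpa using (summable_nat_add_iff 1).mpr (Real.summable_nat_rpow.mpr (by linarith : -σ < -1))
  have h2 := (h1.mul_of_nonneg h1 (fun n ↦ by positivity) (fun n ↦ by positivity)).mul_left
    ((2 * √A * √C) ^ (-σ))
  refine h2.of_nonneg_of_le (fun p ↦ by positivity) fun p ↦ ?_
  rw [← Real.mul_rpow (by positivity) (by positivity), ← Real.mul_rpow (by positivity)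
    (by positivity)]
  refine Real.rpow_le_rpow_of_nonpos (by positivity) ?_ (by linarith)
  have := sq_nonneg (√A * ((p.1 : ℝ) + 1) - √C * ((p.2 : ℝ) + 1))
  have eA := Real.sq_sqrt hA.le
  have eC := Real.sq_sqrt hC.le
  nlinarith

/-- The lattice sum `∑_{m, n ≥ 1} (A m² + C n²)^{-s}`. -/
noncomputable def quadraticZeta (A C : ℝ) (s : ℂ) : ℂ :=
  ∑' p : ℕ × ℕ, ((A * ((p.1 : ℝ) + 1) ^ 2 + C * ((p.2 : ℝ) + 1) ^ 2 : ℝ) : ℂ) ^ (-s)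

lemma summable_cpow_quadratic {A C : ℝ} (hA : 0 < A) (hC : 0 < C) {s : ℂ} (hs : 1 < s.re) :
    Summable fun p : ℕ × ℕ ↦
      ((A * ((p.1 : ℝ) + 1) ^ 2 + C * ((p.2 : ℝ) + 1) ^ 2 : ℝ) : ℂ) ^ (-s) := by
  refine (summable_rpow_quadratic hA hC hs).of_norm_bounded fun p ↦ ?_
  rw [norm_cpow_eq_rpow_re_of_pos (by positivity), neg_re]

lemma two_mul_Gammaℝ_mul_quadraticZeta {A C : ℝ} (hA : 0 < A) (hC : 0 < C) {s : ℂ}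
    (hs : 1 < s.re) :
    2 * (Gammaℝ (2 * s) * quadraticZeta A C s) =
      (C : ℂ) ^ (-(1 / 2) : ℂ) * ((A : ℂ) ^ (1 / 2 - s) * completedRiemannZeta (2 * s - 1)) -
        (A : ℂ) ^ (-s) * completedRiemannZeta (2 * s) + mellin (thetaProd A C) s := by
  have h := hasSum_mellin_pi_mul (a := fun _ : ℕ × ℕ ↦ (1 : ℂ))
    (q := fun p ↦ A * ((p.1 : ℝ) + 1) ^ 2 + C * ((p.2 : ℝ) + 1) ^ 2)
    (F := fun t ↦ ((thetaTail (A * t) * thetaTail (C * t) : ℝ) : ℂ)) (s := s)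
    (fun p ↦ Or.inr (by positivity)) (by linarith) (fun t ht ↦ ?_) ?_
  · have h' : mellin (fun t ↦ ((thetaTail (A * t) * thetaTail (C * t) : ℝ) : ℂ)) s =
        Gammaℝ (2 * s) * quadraticZeta A C s := by
      rw [← h.tsum_eq, quadraticZeta, ← tsum_mul_left]
      refine tsum_congr fun p ↦ ?_
      rw [Gammaℝ_def, neg_div, mul_div_cancel_left₀ _ (two_ne_zero' ℂ),
        cpow_neg ((_ : ℝ) : ℂ) s, cpow_neg ((_ : ℝ) : ℂ) s, mul_one, div_eq_mul_inv]
    have hs1 : 1 / 2 < (s + -(1 / 2)).re := by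
      rw [add_re, neg_re]
      norm_num
      linarith
    have m1 := mellinConvergent_thetaTail hA (s := s) (by linarith)
    have m2 := (MellinConvergent.cpow_smul.mpr (mellinConvergent_thetaTail hA hs1)).const_smul
      ((C : ℂ) ^ (-(1 / 2) : ℂ))
    have m3 := hasMellin_sub m2 m1
    have m4 := hasMellin_add m3.1 (mellinConvergent_thetaProd hA hC s)
    calc 2 * (Gammaℝ (2 * s) * quadraticZeta A C s)
      _ = mellin (fun t ↦ (2 : ℂ) • ((thetaTail (A * t) * thetaTail (C * t) : ℝ) : ℂ)) s := by
        rw [mellin_const_smul, h', smul_eq_mul]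
      _ = mellin (fun t ↦ (C : ℂ) ^ (-(1 / 2) : ℂ) • ((t : ℂ) ^ (-(1 / 2) : ℂ) •
            (thetaTail (A * t) : ℂ)) - (thetaTail (A * t) : ℂ) + thetaProd A C t) s := by
        refine setIntegral_congr_fun measurableSet_Ioi fun t ht ↦ ?_
        simp only
        rw [← two_mul_thetaTail_mul hC ht, smul_eq_mul 2]
      _ = _ := by
        rw [m4.2, m3.2, mellin_const_smul, mellin_cpow_smul, mellin_thetaTail hA hs1,
          mellin_thetaTail hA (by linarith), smul_eq_mul]
        ring_nf
  · have h1 := hasSum_thetaTail (mul_pos hA ht)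
    have h2 := hasSum_thetaTail (mul_pos hC ht)
    have h3 := h1.mul h2 (h1.summable.mul_of_nonneg h2.summable
      (fun n ↦ (Real.exp_pos _).le) fun n ↦ (Real.exp_pos _).le)
    refine (Complex.hasSum_ofReal.mpr h3).congr_fun fun p ↦ ?_
    rw [one_mul, ← Real.exp_add]
    congr 2
    ring
  · refine (summable_rpow_quadratic hA hC hs).congr fun p ↦ ?_
    rw [Real.rpow_neg (by positivity)]
    simp

lemma hasSum_mul_succ_sq_cpow {A : ℝ} (hA : 0 < A) {s : ℂ} (hs : 1 < s.re) :
    HasSum (fun n : ℕ ↦ ((A * ((n : ℝ) + 1) ^ 2 : ℝ) : ℂ) ^ (-s))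
      ((A : ℂ) ^ (-s) * riemannZeta (2 * s)) := by
  have hs' : 1 < (2 * s).re := by simp; linarith
  have h1 : Summable fun n : ℕ ↦ 1 / ((n : ℂ) + 1) ^ (2 * s) := by
    simpa using (summable_nat_add_iff 1).mpr (Complex.summable_one_div_nat_cpow.mpr hs')
  rw [zeta_eq_tsum_one_div_nat_add_one_cpow hs']
  refine (h1.hasSum.mul_left _).congr_fun fun n ↦ ?_
  rw [ofReal_mul, mul_cpow_ofReal_nonneg hA.le (by positivity), cpow_neg ((_ ^ 2 : ℝ) : ℂ),
    two_mul s, cpow_add _ _ (by norm_cast), one_div, sq, ofReal_mul,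
    mul_cpow_ofReal_nonneg (by positivity) (by positivity)]
  push_cast
  rfl

lemma hasSum_odd_quadratic_cpow {A C : ℝ} (hA : 0 < A) (hC : 0 < C) {s : ℂ}
    (hs : 1 < s.re) :
    HasSum (fun p : ℕ × ℕ ↦
        ((A * (2 * (p.1 : ℝ) + 1) ^ 2 + C * ((p.2 : ℝ) + 1) ^ 2 : ℝ) : ℂ) ^ (-s))
      (quadraticZeta A C s - quadraticZeta (4 * A) C s) := by
  have h := (summable_cpow_quadratic hA hC hs).hasSum
  have h4 := (summable_cpow_quadratic (mul_pos four_pos hA) hC hs).hasSum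
  let e : (ℕ ⊕ ℕ) × ℕ ≃ ℕ × ℕ := Equiv.natSumNatEquivNat.prodCongr (Equiv.refl ℕ)
  let e' : (ℕ × ℕ) ⊕ (ℕ × ℕ) ≃ ℕ × ℕ := (Equiv.sumProdDistrib ℕ ℕ ℕ).symm.trans e
  have h' := e'.hasSum_iff.mpr h
  have hodd : HasSum ((fun p : ℕ × ℕ ↦
      ((A * ((p.1 : ℝ) + 1) ^ 2 + C * ((p.2 : ℝ) + 1) ^ 2 : ℝ) : ℂ) ^ (-s)) ∘ e' ∘ Sum.inr)
      (quadraticZeta (4 * A) C s) := by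
    refine h4.congr_fun fun p ↦ ?_
    simp only [e', e, Function.comp_apply, Equiv.trans_apply, Equiv.sumProdDistrib_symm_apply_right,
      Equiv.prodCongr_apply, Prod.map, Equiv.natSumNatEquivNat_apply, Sum.elim_inr, Equiv.refl_apply]
    congr 2
    push_cast
    ring
  have heven := (h'.summable.comp_injective Sum.inl_injective).hasSum
  rw [quadraticZeta, ← (heven.sum hodd).unique h', add_sub_cancel_right]
  refine heven.congr_fun fun p ↦ ?_
  simp only [e', e, Function.comp_apply, Equiv.trans_apply, Equiv.sumProdDistrib_symm_apply_left,
    Equiv.prodCongr_apply, Prod.map, Equiv.natSumNatEquivNat_apply, Sum.elim_inl, Equiv.refl_apply]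
  push_cast
  rfl

lemma hasDerivAt_integral_gaussian (x : ℝ) :
    HasDerivAt (fun y : ℝ ↦ ∫ u in (0 : ℝ)..y, Real.exp (-u ^ 2)) (Real.exp (-x ^ 2)) x :=
  (by fun_prop : Continuous fun u : ℝ ↦ Real.exp (-u ^ 2)).integral_hasStrictDerivAt 0 x
    |>.hasDerivAt

lemma tendsto_integral_gaussian_atTop :
    Tendsto (fun y : ℝ ↦ ∫ u in (0 : ℝ)..y, Real.exp (-u ^ 2)) atTop (𝓝 (√π / 2)) := by
  have h := intervalIntegral_tendsto_integral_Ioi 0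
    (integrable_exp_neg_mul_sq one_pos).integrableOn tendsto_id
  rw [integral_gaussian_Ioi, div_one] at h
  simpa using h

lemma tendsto_integral_gaussian_atBot :
    Tendsto (fun y : ℝ ↦ ∫ u in (0 : ℝ)..y, Real.exp (-u ^ 2)) atBot (𝓝 (-(√π / 2))) := by
  refine (tendsto_integral_gaussian_atTop.comp tendsto_neg_atBot_atTop).neg.congr fun y ↦ ?_
  have h := intervalIntegral.integral_comp_neg (a := 0) (b := y) fun u : ℝ ↦ Real.exp (-u ^ 2)
  simp only [neg_sq, neg_zero] at h
  rw [h, intervalIntegral.integral_symm, Function.comp_apply]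

lemma integral_exp_neg_sq_mul_sub_sq_div {α γ : ℝ} (hα : 0 < α) (hγ : 0 < γ) :
    IntegrableOn (fun t : ℝ ↦ Real.exp (-(α ^ 2 * t + γ ^ 2 / t)) / (t * √t)) (Ioi 0) ∧
      ∫ t in Ioi (0 : ℝ), Real.exp (-(α ^ 2 * t + γ ^ 2 / t)) / (t * √t) =
        √π / γ * Real.exp (-(2 * α * γ)) := by
  set G : ℝ → ℝ := fun y : ℝ ↦ ∫ u in (0 : ℝ)..y, Real.exp (-u ^ 2) with hG
  set f : ℝ → ℝ := fun t ↦ (Real.exp (-(2 * α * γ)) * G (α * √t - γ / √t) -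
    Real.exp (2 * α * γ) * G (α * √t + γ / √t)) / γ with hf
  set l₀ : ℝ := (Real.exp (-(2 * α * γ)) * (-(√π / 2)) - Real.exp (2 * α * γ) * (√π / 2)) / γ
  have hs0 : Tendsto (fun t : ℝ ↦ √t) (𝓝[>] 0) (𝓝[>] 0) := by
    refine tendsto_nhdsWithin_iff.mpr ⟨?_, ?_⟩
    · simpa using (Real.continuous_sqrt.tendsto 0).mono_left nhdsWithin_le_nhds
    · filter_upwards [self_mem_nhdsWithin] with t ht using Real.sqrt_pos.mpr ht
  have hs0' : Tendsto (fun t : ℝ ↦ α * √t) (𝓝[>] 0) (𝓝 0) := by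
    simpa using (hs0.mono_right nhdsWithin_le_nhds).const_mul α
  have hi0 : Tendsto (fun t : ℝ ↦ γ / √t) (𝓝[>] 0) atTop :=
    (tendsto_inv_nhdsGT_zero.comp hs0).const_mul_atTop hγ
  have hs1 : Tendsto (fun t : ℝ ↦ α * √t) atTop atTop :=
    Real.tendsto_sqrt_atTop.const_mul_atTop hα
  have hi1 : Tendsto (fun t : ℝ ↦ γ / √t) atTop (𝓝 0) :=
    Real.tendsto_sqrt_atTop.const_div_atTop γ
  have hf0 : Tendsto f (𝓝[>] 0) (𝓝 l₀) := by
    refine (((tendsto_integral_gaussian_atBot.comp ?_).const_mul _).sub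
      ((tendsto_integral_gaussian_atTop.comp ?_).const_mul _)).div_const _
    · simp_rw [sub_eq_add_neg]
      exact hs0'.add_atBot (tendsto_neg_atTop_atBot.comp hi0)
    · exact hs0'.add_atTop hi0
  have hf1 : Tendsto f atTop (𝓝 ((Real.exp (-(2 * α * γ)) * (√π / 2) -
      Real.exp (2 * α * γ) * (√π / 2)) / γ)) := by
    refine (((tendsto_integral_gaussian_atTop.comp ?_).const_mul _).sub
      ((tendsto_integral_gaussian_atTop.comp ?_).const_mul _)).div_const _
    · simp_rw [sub_eq_add_neg]
      exact hs1.atTop_add hi1.neg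
    · exact hs1.atTop_add hi1
  have hcont : ContinuousWithinAt (Function.update f 0 l₀) (Ici 0) 0 := by
    rw [continuousWithinAt_update_same]
    simpa using hf0
  have hupd : Function.update f 0 l₀ =ᶠ[atTop] f := by
    filter_upwards [eventually_ne_atTop 0] with t ht using Function.update_of_ne ht _ _
  have hderiv : ∀ t ∈ Ioi (0 : ℝ), HasDerivAt (Function.update f 0 l₀)
      (Real.exp (-(α ^ 2 * t + γ ^ 2 / t)) / (t * √t)) t := by
    intro t ht
    have ht : 0 < t := ht
    have hst : 0 < √t := Real.sqrt_pos.mpr ht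
    refine HasDerivAt.congr_of_eventuallyEq ?_ (f := f) ?_
    · have h1 := (Real.hasDerivAt_sqrt ht.ne').const_mul α
      have h2 := ((Real.hasDerivAt_sqrt ht.ne').inv hst.ne').const_mul γ
      have h3 := (hasDerivAt_integral_gaussian _).comp t (h1.sub h2)
      have h4 := (hasDerivAt_integral_gaussian _).comp t (h1.add h2)
      have h5 := ((h3.const_mul (Real.exp (-(2 * α * γ)))).sub
        (h4.const_mul (Real.exp (2 * α * γ)))).div_const γ
      refine h5.congr_deriv ?_
      have e1 : Real.exp (-(2 * α * γ)) * Real.exp (-(α * √t - γ * (√t)⁻¹) ^ 2) =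
          Real.exp (-(α ^ 2 * t + γ ^ 2 / t)) := by
        rw [← Real.exp_add]
        congr 1
        have := Real.sq_sqrt ht.le
        field_simp
        grind
      have e2 : Real.exp (2 * α * γ) * Real.exp (-(α * √t + γ * (√t)⁻¹) ^ 2) =
          Real.exp (-(α ^ 2 * t + γ ^ 2 / t)) := by
        rw [← Real.exp_add]
        congr 1
        have := Real.sq_sqrt ht.le
        field_simp
        grind
      simp only [Pi.sub_apply, Pi.add_apply, Pi.inv_apply]
      rw [← mul_assoc, ← mul_assoc, e1, e2, Real.sq_sqrt ht.le]
      field_simp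
      ring
    · filter_upwards [eventually_ne_nhds ht.ne'] with x hx using Function.update_of_ne hx _ _
  have hpos : ∀ t ∈ Ioi (0 : ℝ), 0 ≤ Real.exp (-(α ^ 2 * t + γ ^ 2 / t)) / (t * √t) := by
    intro t ht
    have ht : 0 < t := ht
    positivity
  refine ⟨integrableOn_Ioi_deriv_of_nonneg hcont hderiv hpos (hf1.congr' hupd.symm), ?_⟩
  rw [integral_Ioi_of_hasDerivAt_of_nonneg hcont hderiv hpos (hf1.congr' hupd.symm),
    Function.update_self]
  simp only [l₀]
  ring

lemma exp_neg_mul_succ (x : ℝ) (n : ℕ) :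
    Real.exp (-(2 * π * x * ((n : ℝ) + 1))) = Real.exp (-(2 * π * x)) ^ (n + 1) := by
  rw [← Real.exp_nat_mul]
  push_cast
  ring_nf

lemma exp_neg_two_pi_mul_lt_one {x : ℝ} (hx : 0 < x) : Real.exp (-(2 * π * x)) < 1 := by
  rw [Real.exp_lt_one_iff]
  exact neg_lt_zero.mpr (by positivity)

lemma exp_neg_mul_succ_lt_one {x : ℝ} (hx : 0 < x) (n : ℕ) :
    Real.exp (-(2 * π * x * ((n : ℝ) + 1))) < 1 := by
  rw [Real.exp_lt_one_iff]
  exact neg_lt_zero.mpr (by positivity)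

lemma summable_exp_neg_mul_succ {x : ℝ} (hx : 0 < x) :
    Summable fun n : ℕ ↦ Real.exp (-(2 * π * x * ((n : ℝ) + 1))) := by
  simp_rw [exp_neg_mul_succ]
  exact (summable_nat_add_iff 1).mpr
    (summable_geometric_of_lt_one (Real.exp_pos _).le (exp_neg_two_pi_mul_lt_one hx))

/-- The logarithm of the product `∏_{k ≥ 1} (1 - e^{-2 π k x})`. -/
noncomputable def logEtaProd (x : ℝ) : ℝ :=
  ∑' k : ℕ, Real.log (1 - Real.exp (-(2 * π * x * ((k : ℝ) + 1))))

lemma summable_log_one_sub_exp {x : ℝ} (hx : 0 < x) :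
    Summable fun k : ℕ ↦ Real.log (1 - Real.exp (-(2 * π * x * ((k : ℝ) + 1)))) := by
  simp_rw [sub_eq_add_neg]
  exact Real.summable_log_one_add_of_summable (summable_exp_neg_mul_succ hx).neg

lemma summable_exp_neg_mul_mul_div {x : ℝ} (hx : 0 < x) :
    Summable fun p : ℕ × ℕ ↦ 2 / ((p.2 : ℝ) + 1) *
      Real.exp (-(2 * π * x * (((p.1 : ℝ) + 1) * ((p.2 : ℝ) + 1)))) := by
  set r := Real.exp (-(2 * π * x))
  have h1 : Summable fun n : ℕ ↦ r ^ n :=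
    summable_geometric_of_lt_one (Real.exp_pos _).le (exp_neg_two_pi_mul_lt_one hx)
  refine ((h1.mul_of_nonneg h1 (fun n ↦ by positivity) fun n ↦ by positivity).mul_left
    2).of_nonneg_of_le (fun p ↦ by positivity) fun p ↦ ?_
  refine mul_le_mul ?_ ?_ (Real.exp_pos _).le zero_le_two
  · rw [div_le_iff₀ (by positivity)]
    linarith [(Nat.cast_nonneg p.2 : (0 : ℝ) ≤ p.2)]
  · rw [← Real.exp_nat_mul, ← Real.exp_nat_mul, ← Real.exp_add, Real.exp_le_exp]
    have h : (p.1 : ℝ) + p.2 ≤ ((p.1 : ℝ) + 1) * ((p.2 : ℝ) + 1) := by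
      have : (0 : ℝ) ≤ (p.1 : ℝ) * p.2 := by positivity
      linarith
    nlinarith [mul_le_mul_of_nonneg_left h (by positivity : 0 ≤ 2 * π * x)]

lemma mellin_thetaProd_zero {A C : ℝ} (hA : 0 < A) (hC : 0 < C) :
    mellin (thetaProd A C) 0 = ((-2 * logEtaProd √(A / C) : ℝ) : ℂ) := by
  set x := √(A / C)
  have hx : 0 < x := Real.sqrt_pos.mpr (by positivity)
  let F : ℕ × ℕ → ℝ → ℝ := fun p t ↦ 2 * (√C)⁻¹ *
    (Real.exp (-((√(π * A) * ((p.1 : ℝ) + 1)) ^ 2 * t + (√(π / C) * ((p.2 : ℝ) + 1)) ^ 2 / t)) /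
      (t * √t))
  have hK (p : ℕ × ℕ) := integral_exp_neg_sq_mul_sub_sq_div
    (show 0 < √(π * A) * ((p.1 : ℝ) + 1) by positivity)
    (show 0 < √(π / C) * ((p.2 : ℝ) + 1) by positivity)
  have hFint (p : ℕ × ℕ) : ∫ t in Ioi 0, F p t = 2 / ((p.2 : ℝ) + 1) *
      Real.exp (-(2 * π * x * (((p.1 : ℝ) + 1) * ((p.2 : ℝ) + 1)))) := by
    simp only [F]
    rw [integral_const_mul, (hK p).2]
    have hs : √C ≠ 0 := by positivity
    have hp : √π ≠ 0 := by positivity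
    have e : 2 * (√(π * A) * ((p.1 : ℝ) + 1)) * (√(π / C) * ((p.2 : ℝ) + 1)) =
        2 * π * x * (((p.1 : ℝ) + 1) * ((p.2 : ℝ) + 1)) := by
      simp only [x]
      rw [Real.sqrt_mul pi_pos.le, Real.sqrt_div pi_pos.le, Real.sqrt_div hA.le]
      field_simp
      rw [Real.sq_sqrt pi_pos.le]
    rw [e, Real.sqrt_div pi_pos.le]
    field_simp
  have hnorm (p : ℕ × ℕ) : ∫ t in Ioi 0, ‖F p t‖ = ∫ t in Ioi 0, F p t := by
    refine setIntegral_congr_fun measurableSet_Ioi fun t ht ↦ ?_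
    have ht : 0 < t := ht
    exact Real.norm_of_nonneg (by positivity)
  have h1 := hasSum_integral_of_summable_integral_norm (F := F)
    (fun p ↦ (hK p).1.const_mul _) (by
      simp_rw [hnorm, hFint]
      exact summable_exp_neg_mul_mul_div hx)
  simp_rw [hFint] at h1
  have h2 : HasSum (fun k : ℕ ↦ -2 * Real.log (1 - Real.exp (-(2 * π * x * ((k : ℝ) + 1)))))
      (∫ t in Ioi 0, ∑' p, F p t) := by
    refine h1.prod_fiberwise fun k ↦ ?_
    have hlt : |Real.exp (-(2 * π * x * ((k : ℝ) + 1)))| < 1 := by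
      rw [abs_of_pos (Real.exp_pos _)]
      exact exp_neg_mul_succ_lt_one hx k
    have h := (Real.hasSum_pow_div_log_of_abs_lt_one hlt).mul_left 2
    rw [← neg_mul_comm] at h
    refine h.congr_fun fun n ↦ ?_
    rw [← Real.exp_nat_mul]
    push_cast
    ring_nf
  have h3 : logEtaProd x * -2 = ∫ t in Ioi 0, ∑' p, F p t := by
    rw [← h2.tsum_eq, tsum_mul_left, mul_comm, logEtaProd]
  rw [mul_comm, h3, ← integral_complex_ofReal]
  refine setIntegral_congr_fun measurableSet_Ioi fun t ht ↦ ?_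
  have ht : 0 < t := ht
  have a1 := hasSum_thetaTail (mul_pos hA ht)
  have a2 := hasSum_thetaTail (inv_pos.mpr (mul_pos hC ht))
  have a3 := (a1.mul a2 (a1.summable.mul_of_nonneg a2.summable
    (fun n ↦ (Real.exp_pos _).le) fun n ↦ (Real.exp_pos _).le)).mul_left (2 * (√C)⁻¹ / (t * √t))
  have a4 : HasSum (fun p ↦ F p t)
      (2 * (√C)⁻¹ / (t * √t) * (thetaTail (A * t) * thetaTail (C * t)⁻¹)) := by
    refine a3.congr_fun fun p ↦ ?_
    simp only [F]
    rw [← Real.exp_add, mul_pow, mul_pow, Real.sq_sqrt (by positivity),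
      Real.sq_sqrt (by positivity)]
    have e : -(π * A * ((p.1 : ℝ) + 1) ^ 2 * t + π / C * ((p.2 : ℝ) + 1) ^ 2 / t) =
      -π * ((p.1 : ℝ) + 1) ^ 2 * (A * t) + -π * ((p.2 : ℝ) + 1) ^ 2 * (C * t)⁻¹ := by
      field_simp
      ring
    rw [e]
    ring
  rw [a4.tsum_eq, thetaProd, smul_eq_mul, zero_sub, cpow_neg_one, ← ofReal_inv, ← ofReal_mul,
    Real.rpow_neg hC.le, Real.rpow_neg ht.le, ← Real.sqrt_eq_rpow, ← Real.sqrt_eq_rpow]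
  congr 1
  field_simp

open UpperHalfPlane ModularForm in
lemma norm_eta_I_mul {x : ℝ} (hx : 0 < x) :
    ‖ModularForm.eta (Complex.I * x)‖ = Real.exp (-(π * x / 12) + logEtaProd x) := by
  have hz : Complex.I * x ∈ upperHalfPlaneSet := by simpa using hx
  have hm := multipliableLocallyUniformlyOn_eta.multipliable hz
  have hq (n : ℕ) : 1 - eta_q n (Complex.I * x) =
      ((1 - Real.exp (-(2 * π * x * ((n : ℝ) + 1))) : ℝ) : ℂ) := by
    rw [eta_q_eq_cexp]
    push_cast
    congr 2
    linear_combination (2 * π * ((n : ℂ) + 1) * x) * Complex.I_mul_I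
  rw [ModularForm.eta, norm_mul, hm.norm_tprod, Real.exp_add, logEtaProd,
    Real.rexp_tsum_eq_tprod (fun n ↦ sub_pos.mpr (exp_neg_mul_succ_lt_one hx n))
      (summable_log_one_sub_exp hx)]
  congr 1
  · rw [Function.Periodic.qParam, Complex.norm_exp]
    congr 1
    have : 2 * (π : ℂ) * Complex.I * (Complex.I * x) / ((24 : ℝ) : ℂ) =
        ((-(π * x / 12) : ℝ) : ℂ) := by
      push_cast
      linear_combination (2 * π * x / 24 : ℂ) * Complex.I_mul_I
    rw [this, ofReal_re]
  · refine tprod_congr fun n ↦ ?_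
    rw [hq, norm_real, Real.norm_of_nonneg]
    exact (sub_pos.mpr (exp_neg_mul_succ_lt_one hx n)).le

open UpperHalfPlane ModularForm in
lemma logEtaProd_inv {x : ℝ} (hx : 0 < x) :
    logEtaProd x⁻¹ - π * x⁻¹ / 12 = Real.log x / 2 + logEtaProd x - π * x / 12 := by
  have hz : Complex.I * x ∈ upperHalfPlaneSet := by simpa using hx
  have h := congrArg norm (eta_comp_eq_csqrt_I_inv hz)
  have e : -1 / (Complex.I * x) = Complex.I * (x⁻¹ : ℝ) := by
    rw [div_eq_iff (mul_ne_zero Complex.I_ne_zero (ofReal_ne_zero.mpr hx.ne')), ofReal_inv]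
    have : (x : ℂ) ≠ 0 := ofReal_ne_zero.mpr hx.ne'
    field_simp
    simp
  have hsqrt (z : ℂ) : ‖z.sqrt‖ ^ 2 = ‖z‖ := by
    rw [← norm_pow, Complex.sqrt, cpow_ofNat_inv_pow]
  have hI : ‖Complex.I.sqrt‖ = 1 := by
    rw [← pow_eq_one_iff_of_nonneg (norm_nonneg _) two_ne_zero, hsqrt, Complex.norm_I]
  have hx' : ‖(Complex.I * x).sqrt‖ = Real.exp (Real.log x / 2) := by
    rw [← sq_eq_sq₀ (norm_nonneg _) (Real.exp_pos _).le, hsqrt, ← Real.exp_nat_mul]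
    push_cast
    rw [mul_div_cancel₀ _ two_ne_zero, Real.exp_log hx, norm_mul, Complex.norm_I, one_mul,
      norm_real, Real.norm_of_nonneg hx.le]
  simp only [Function.comp_apply, Pi.smul_apply, Pi.mul_apply, smul_eq_mul, norm_mul, norm_inv,
    hI, hx', inv_one, one_mul, e, norm_eta_I_mul hx, norm_eta_I_mul (inv_pos.mpr hx)] at h
  rw [← Real.exp_add, Real.exp_eq_exp] at h
  linarith

lemma hasDerivAt_Gammaℝ_inv_zero : HasDerivAt (fun s ↦ (Gammaℝ s)⁻¹) (1 / 2) 0 := by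
  rw [hasDerivAt_iff_tendsto_slope_zero]
  have h := Gammaℝ_residue_zero.inv₀ two_ne_zero
  rw [← one_div] at h
  refine h.congr fun t ↦ ?_
  have h0 : Gammaℝ 0 = 0 := by simp [Gammaℝ_def]
  simp [h0, mul_comm]

/-- The continuation of `2 ∑ (A m² + C n²)^{-s} + (2 (4A)^{-s} + C^{-s}) ζ(2s)`, which is the
spectral zeta function of the Klein bottle for `A = π² / a²` and `C = 1 / ρ²`. The value at
`s = 1 / 2`, where this formula has a removable singularity, is not meaningful. -/
noncomputable def spectralZeta (A C : ℝ) (s : ℂ) : ℂ :=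
  (Gammaℝ (2 * s))⁻¹ * ((C : ℂ) ^ (-(1 / 2) : ℂ) *
    ((A : ℂ) ^ (1 / 2 - s) * completedRiemannZeta (2 * s - 1)) + mellin (thetaProd A C) s) +
    (2 * ((4 * A : ℝ) : ℂ) ^ (-s) + (C : ℂ) ^ (-s) - (A : ℂ) ^ (-s)) * riemannZeta (2 * s)

lemma spectralZeta_eq {A C : ℝ} (hA : 0 < A) (hC : 0 < C) {s : ℂ} (hs : 1 < s.re) :
    spectralZeta A C s = 2 * quadraticZeta A C s +
      2 * (((4 * A : ℝ) : ℂ) ^ (-s) * riemannZeta (2 * s)) +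
      (C : ℂ) ^ (-s) * riemannZeta (2 * s) := by
  have h := two_mul_Gammaℝ_mul_quadraticZeta hA hC hs
  have hG : Gammaℝ (2 * s) ≠ 0 := Gammaℝ_ne_zero_of_re_pos (by simp; linarith)
  have h2s : 2 * s ≠ 0 := by
    intro h0
    have := congrArg re h0
    simp at this
    linarith
  rw [spectralZeta, riemannZeta_def_of_ne_zero h2s]
  generalize (A : ℂ) ^ (1 / 2 - s) = u at h ⊢
  field_simp
  linear_combination -h

lemma differentiableAt_ofReal_cpow {A : ℝ} (hA : 0 < A) {f : ℂ → ℂ} {s : ℂ}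
    (hf : DifferentiableAt ℂ f s) : DifferentiableAt ℂ (fun s ↦ (A : ℂ) ^ f s) s :=
  hf.const_cpow (Or.inl (ofReal_ne_zero.mpr hA.ne'))

lemma differentiableAt_spectralZeta {A C : ℝ} (hA : 0 < A) (hC : 0 < C) {s : ℂ}
    (hs : s ≠ 1) (hs' : s ≠ 1 / 2) : DifferentiableAt ℂ (spectralZeta A C) s := by
  have h1 : DifferentiableAt ℂ (fun s ↦ (Gammaℝ (2 * s))⁻¹) s :=
    DifferentiableAt.comp s (g := fun s ↦ (Gammaℝ s)⁻¹) (differentiable_Gammaℝ_inv _) (by fun_prop)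
  have h2 : DifferentiableAt ℂ (fun s ↦ completedRiemannZeta (2 * s - 1)) s := by
    refine DifferentiableAt.comp s (g := completedRiemannZeta)
      (differentiableAt_completedZeta (fun h ↦ hs' ?_) fun h ↦ hs ?_) (by fun_prop)
    · linear_combination h / 2
    · linear_combination h / 2
  have h3 : DifferentiableAt ℂ (fun s ↦ riemannZeta (2 * s)) s := by
    refine DifferentiableAt.comp s (g := riemannZeta)
      (differentiableAt_riemannZeta fun h ↦ hs' ?_) (by fun_prop)
    linear_combination h / 2
  have h4 {B : ℝ} (hB : 0 < B) : DifferentiableAt ℂ (fun s : ℂ ↦ (B : ℂ) ^ (-s)) s :=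
    differentiableAt_ofReal_cpow hB (by fun_prop)
  have h5 : DifferentiableAt ℂ (fun s : ℂ ↦ (A : ℂ) ^ (1 / 2 - s)) s :=
    differentiableAt_ofReal_cpow hA (by fun_prop)
  exact (h1.mul (((h5.mul h2).const_mul _).add (differentiable_mellin_thetaProd hA hC s))).add
    (((((h4 (mul_pos four_pos hA)).const_mul 2).add (h4 hC)).sub (h4 hA)).mul h3)

lemma tendsto_sub_half_mul_spectralZeta {A C : ℝ} (hA : 0 < A) (hC : 0 < C) :
    Tendsto (fun s ↦ (s - 1 / 2) * spectralZeta A C s) (𝓝[≠] (1 / 2)) (𝓝 0) := by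
  have hc {f : ℂ → ℂ} (hf : DifferentiableAt ℂ f (1 / 2)) :
      Tendsto f (𝓝[≠] (1 / 2)) (𝓝 (f (1 / 2))) :=
    hf.continuousAt.tendsto.mono_left nhdsWithin_le_nhds
  have h1 : Tendsto (fun s : ℂ ↦ (s - 1 / 2) * completedRiemannZeta (2 * s - 1))
      (𝓝[≠] (1 / 2)) (𝓝 (-1 / 2)) := by
    have h := (completedHurwitzZetaEven_residue_zero 0)
    rw [if_pos rfl] at h
    have hmap : Tendsto (fun s : ℂ ↦ 2 * s - 1) (𝓝[≠] (1 / 2)) (𝓝[≠] 0) := by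
      refine tendsto_nhdsWithin_iff.mpr ⟨?_, ?_⟩
      · have := hc (f := fun s ↦ 2 * s - 1) (by fun_prop)
        norm_num at this ⊢
        exact this
      · filter_upwards [self_mem_nhdsWithin] with s hs h
        exact hs (by simp only [mem_singleton_iff] at h ⊢; linear_combination h / 2)
    refine ((h.comp hmap).div_const 2).congr fun s ↦ ?_
    simp only [Function.comp_apply]
    change (2 * s - 1) * completedRiemannZeta (2 * s - 1) / 2 = _
    ring
  have h2 : Tendsto (fun s : ℂ ↦ (s - 1 / 2) * riemannZeta (2 * s))
      (𝓝[≠] (1 / 2)) (𝓝 (1 / 2)) := by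
    have hmap : Tendsto (fun s : ℂ ↦ 2 * s) (𝓝[≠] (1 / 2)) (𝓝[≠] 1) := by
      refine tendsto_nhdsWithin_iff.mpr ⟨?_, ?_⟩
      · have := hc (f := fun s ↦ 2 * s) (by fun_prop)
        norm_num at this ⊢
        exact this
      · filter_upwards [self_mem_nhdsWithin] with s hs h
        exact hs (by simp only [mem_singleton_iff] at h ⊢; linear_combination h / 2)
    refine ((riemannZeta_residue_one.comp hmap).div_const 2).congr fun s ↦ ?_
    simp only [Function.comp_apply]
    ring
  have h3 := hc (f := fun s ↦ (Gammaℝ (2 * s))⁻¹)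
    (DifferentiableAt.comp _ (g := fun s ↦ (Gammaℝ s)⁻¹) (differentiable_Gammaℝ_inv _)
      (by fun_prop))
  have h4 {B : ℝ} (hB : 0 < B) := hc (f := fun s : ℂ ↦ (B : ℂ) ^ (-s))
    (differentiableAt_ofReal_cpow hB (by fun_prop))
  have h5 := hc (f := fun s : ℂ ↦ (A : ℂ) ^ (1 / 2 - s))
    (differentiableAt_ofReal_cpow hA (by fun_prop))
  have h6 := hc (f := fun s : ℂ ↦ (s - 1 / 2) * mellin (thetaProd A C) s)
    (DifferentiableAt.mul (by fun_prop) (differentiable_mellin_thetaProd hA hC _))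
  have h7 := (h3.mul (((h5.mul h1).const_mul ((C : ℂ) ^ (-(1 / 2) : ℂ))).add h6)).add
    (((((h4 (mul_pos four_pos hA)).const_mul 2).add (h4 hC)).sub (h4 hA)).mul h2)
  have e : ((4 * A : ℝ) : ℂ) ^ (-(1 / 2) : ℂ) = (A : ℂ) ^ (-(1 / 2) : ℂ) / 2 := by
    rw [ofReal_mul, mul_cpow_ofReal_nonneg four_pos.le hA.le]
    have : ((4 : ℝ) : ℂ) ^ (-(1 / 2) : ℂ) = ((2 : ℝ)⁻¹ : ℝ) := by
      rw [show (-(1 / 2) : ℂ) = ((-(1 / 2) : ℝ) : ℂ) by push_cast; ring, ← ofReal_cpow four_pos.le,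
        show (4 : ℝ) = 2 ^ (2 : ℝ) by norm_num, ← Real.rpow_mul two_pos.le]
      norm_num [Real.rpow_neg_one]
    rw [this]
    push_cast
    ring
  have e2 : (2 : ℂ) * (1 / 2) = 1 := by norm_num
  rw [e, e2, Gammaℝ_one, sub_self, cpow_zero] at h7
  convert! h7.congr fun s ↦ ?_ using 2
  · ring
  · rw [spectralZeta]
    ring

lemma hasDerivAt_spectralZeta_zero {A C : ℝ} (hA : 0 < A) (hC : 0 < C) :
    HasDerivAt (spectralZeta A C)
      ((√(A / C) * π / 6 - 2 * logEtaProd √(A / C) + Real.log (4 * A) + Real.log C / 2 -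
        Real.log A / 2 - 2 * Real.log (2 * π) : ℝ) : ℂ) 0 := by
  have h1 : HasDerivAt (fun s ↦ (Gammaℝ (2 * s))⁻¹) 1 0 := by
    have := HasDerivAt.comp (0 : ℂ) (h₂ := fun s ↦ (Gammaℝ s)⁻¹)
      (by simpa using hasDerivAt_Gammaℝ_inv_zero) ((hasDerivAt_id (0 : ℂ)).const_mul 2)
    simpa [Function.comp_def] using this
  have h2 : DifferentiableAt ℂ (fun s ↦ completedRiemannZeta (2 * s - 1)) 0 :=
    DifferentiableAt.comp _ (g := completedRiemannZeta)
      (differentiableAt_completedZeta (by norm_num) (by norm_num)) (by fun_prop)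
  have h3 : HasDerivAt (fun s ↦ riemannZeta (2 * s)) (-Real.log (2 * π) : ℝ) 0 := by
    have h0 : HasDerivAt riemannZeta (-Complex.log (2 * π) / 2) (2 * 0) := by
      rw [mul_zero, ← deriv_riemannZeta_zero]
      exact (differentiableAt_riemannZeta zero_ne_one).hasDerivAt
    refine (h0.comp (0 : ℂ) ((hasDerivAt_id (0 : ℂ)).const_mul 2)).congr_deriv ?_
    push_cast [ofReal_log (by positivity : 0 ≤ 2 * π)]
    ring
  have h4 {B : ℝ} (hB : 0 < B) : HasDerivAt (fun s : ℂ ↦ (B : ℂ) ^ (-s)) (-Real.log B : ℝ) 0 := by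
    have := (hasDerivAt_neg (0 : ℂ)).const_cpow (c := B) (Or.inl (ofReal_ne_zero.mpr hB.ne'))
    simpa [ofReal_log hB.le] using this
  have h5 : DifferentiableAt ℂ (fun s : ℂ ↦ (A : ℂ) ^ (1 / 2 - s)) 0 :=
    differentiableAt_ofReal_cpow hA (by fun_prop)
  have h6 := (h1.mul (((h5.mul h2).const_mul ((C : ℂ) ^ (-(1 / 2) : ℂ))).add
    (differentiable_mellin_thetaProd hA hC 0)).hasDerivAt).add
    (((((h4 (mul_pos four_pos hA)).const_mul 2).add (h4 hC)).sub (h4 hA)).mul h3)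
  refine h6.congr_deriv ?_
  have hΛ : completedRiemannZeta (-1) = π / 6 := by
    rw [show (-1 : ℂ) = 1 - 2 by norm_num, completedRiemannZeta_one_sub]
    have h := riemannZeta_def_of_ne_zero two_ne_zero
    have hG : Gammaℝ 2 = (π : ℂ)⁻¹ := by
      rw [Gammaℝ_def, neg_div, div_self two_ne_zero, cpow_neg_one, Complex.Gamma_one, mul_one]
    rw [riemannZeta_two, hG] at h
    have hpi : (π : ℂ) ≠ 0 := ofReal_ne_zero.mpr pi_ne_zero
    field_simp at h
    rw [h]
    ring
  have hsq : (C : ℂ) ^ (-(1 / 2) : ℂ) * (A : ℂ) ^ (1 / 2 : ℂ) = (√(A / C) : ℝ) := by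
    rw [Real.sqrt_div hA.le, Real.sqrt_eq_rpow, Real.sqrt_eq_rpow, ofReal_div,
      ofReal_cpow hA.le, ofReal_cpow hC.le, cpow_neg]
    push_cast
    ring
  have hG0 : (Gammaℝ 0)⁻¹ = 0 := by simp [Gammaℝ_def]
  simp only [Pi.add_apply, Pi.mul_apply, Pi.sub_apply, mul_zero, zero_sub, sub_zero, neg_zero, cpow_zero, hG0,
    hΛ, riemannZeta_zero, mellin_thetaProd_zero hA hC]
  rw [← mul_assoc ((C : ℂ) ^ _), hsq]
  push_cast
  ring

lemma exists_continuation_spectralZeta {A C : ℝ} (hA : 0 < A) (hC : 0 < C) :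
    ∃ f : ℂ → ℂ, (∀ s : ℂ, s ≠ 1 → DifferentiableAt ℂ f s) ∧
      ∀ s : ℂ, s ≠ 1 / 2 → f s = spectralZeta A C s := by
  have hopen : IsOpen ({1}ᶜ : Set ℂ) := isOpen_compl_singleton
  refine ⟨Function.update (spectralZeta A C) (1 / 2)
    (limUnder (𝓝[≠] (1 / 2)) (spectralZeta A C)), fun s hs ↦ ?_,
    fun s hs ↦ Function.update_of_ne hs _ _⟩
  refine (Complex.differentiableOn_update_limUnder_of_isLittleO
    (hopen.mem_nhds (by norm_num : (1 / 2 : ℂ) ∈ ({1}ᶜ : Set ℂ)))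
    (fun z hz ↦ (differentiableAt_spectralZeta hA hC hz.1 hz.2).differentiableWithinAt)
    ?_).differentiableAt (hopen.mem_nhds hs)
  refine isLittleO_of_tendsto' ?_ ?_
  · filter_upwards [self_mem_nhdsWithin] with z hz h
    exact absurd (inv_eq_zero.mp h) (sub_ne_zero.mpr hz)
  · have h : Tendsto (fun s : ℂ ↦ (s - 1 / 2) * spectralZeta A C (1 / 2))
        (𝓝[≠] (1 / 2)) (𝓝 0) := by
      have : ContinuousAt (fun s : ℂ ↦ (s - 1 / 2) * spectralZeta A C (1 / 2)) (1 / 2) := by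
        fun_prop
      simpa using this.tendsto.mono_left nhdsWithin_le_nhds
    refine (((tendsto_sub_half_mul_spectralZeta hA hC).sub h).congr fun s ↦ ?_).trans
      (by rw [sub_zero])
    rw [div_inv_eq_mul]
    ring

lemma hasSum_log_one_add_two_div {x : ℝ} (hx : 0 < x) :
    HasSum (fun k : ℕ ↦ Real.log (1 + 2 / (Real.exp (2 * π * x * ((k : ℝ) + 1)) - 1)))
      (logEtaProd (2 * x) - 2 * logEtaProd x) := by
  refine ((summable_log_one_sub_exp (mul_pos two_pos hx)).hasSum.sub
    ((summable_log_one_sub_exp hx).hasSum.mul_left 2)).congr_fun fun k ↦ ?_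
  have hr := exp_neg_mul_succ_lt_one hx k
  have h2 : Real.exp (-(2 * π * (2 * x) * ((k : ℝ) + 1))) =
      Real.exp (-(2 * π * x * ((k : ℝ) + 1))) ^ 2 := by
    rw [← Real.exp_nat_mul]
    push_cast
    ring_nf
  have h3 : Real.exp (2 * π * x * ((k : ℝ) + 1)) =
      (Real.exp (-(2 * π * x * ((k : ℝ) + 1))))⁻¹ := by
    rw [Real.exp_neg, inv_inv]
  rw [h2, h3]
  have hpos := Real.exp_pos (-(2 * π * x * ((k : ℝ) + 1)))
  generalize Real.exp (-(2 * π * x * ((k : ℝ) + 1))) = r at hr hpos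
  have h1r : 0 < 1 - r := sub_pos.mpr hr
  have e : 1 + 2 / (r⁻¹ - 1) = (1 - r ^ 2) / (1 - r) ^ 2 := by
    have e1 : r⁻¹ - 1 = (1 - r) / r := by field_simp
    rw [e1]
    field_simp
    ring
  have h4 : 1 - r ^ 2 ≠ 0 := by nlinarith
  rw [e, Real.log_div h4 (pow_pos h1r 2).ne', Real.log_pow]
  norm_num

end KleinBottle

open KleinBottle

/-- Theorem 2.8: the zeta-determinant of the scalar Laplacian on the Klein
bottle. `Z_K` is the spectral zeta function of `Δ_𝕂`, defined for `Re s > 1`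
by the four (convergent) series below; it has an analytic continuation `f`
holomorphic away from `s = 1`, and
`-f'(0) = 2 log(2πρ) - 2π²ρ/(3a) + 4∑_{k≥1} log(1 - e^{-4π²ρk/a}) + 2∑_{k≥1} log(1 + 2/(e^{ak/ρ}-1))`. -/
theorem stmt_14 (a ρ : ℝ) (ha : 0 < a) (hρ : 0 < ρ) :
    ∃ f : ℂ → ℂ,
      (∀ s : ℂ, s ≠ 1 → DifferentiableAt ℂ f s) ∧
      (∀ s : ℂ, 1 < s.re →
        Summable (fun p : ℕ × ℕ =>
          (((4 * π ^ 2 * ((p.1 : ℝ) + 1) ^ 2 / a ^ 2 +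
              ((p.2 : ℝ) + 1) ^ 2 / ρ ^ 2 : ℝ) : ℂ)) ^ (-s)) ∧
        Summable (fun m : ℕ =>
          (((4 * π ^ 2 * ((m : ℝ) + 1) ^ 2 / a ^ 2 : ℝ) : ℂ)) ^ (-s)) ∧
        Summable (fun m : ℕ => (((((m : ℝ) + 1) ^ 2 / ρ ^ 2 : ℝ) : ℂ)) ^ (-s)) ∧
        Summable (fun p : ℕ × ℕ =>
          (((4 * π ^ 2 * ((p.1 : ℝ) + 1 - 1 / 2) ^ 2 / a ^ 2 +
              ((p.2 : ℝ) + 1) ^ 2 / ρ ^ 2 : ℝ) : ℂ)) ^ (-s)) ∧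
        f s =
          2 * ∑' p : ℕ × ℕ,
              (((4 * π ^ 2 * ((p.1 : ℝ) + 1) ^ 2 / a ^ 2 +
                  ((p.2 : ℝ) + 1) ^ 2 / ρ ^ 2 : ℝ) : ℂ)) ^ (-s) +
            2 * ∑' m : ℕ,
              (((4 * π ^ 2 * ((m : ℝ) + 1) ^ 2 / a ^ 2 : ℝ) : ℂ)) ^ (-s) +
            ∑' m : ℕ, (((((m : ℝ) + 1) ^ 2 / ρ ^ 2 : ℝ) : ℂ)) ^ (-s) +
            2 * ∑' p : ℕ × ℕ,
              (((4 * π ^ 2 * ((p.1 : ℝ) + 1 - 1 / 2) ^ 2 / a ^ 2 +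
                  ((p.2 : ℝ) + 1) ^ 2 / ρ ^ 2 : ℝ) : ℂ)) ^ (-s)) ∧
      Summable (fun k : ℕ =>
        Real.log (1 - Real.exp (-(4 * π ^ 2 * ρ * ((k : ℝ) + 1) / a)))) ∧
      Summable (fun k : ℕ =>
        Real.log (1 + 2 / (Real.exp (a * ((k : ℝ) + 1) / ρ) - 1))) ∧
      -deriv f 0 =
        ((2 * Real.log (2 * π * ρ) - 2 * π ^ 2 * ρ / (3 * a) +
          4 * ∑' k : ℕ,
            Real.log (1 - Real.exp (-(4 * π ^ 2 * ρ * ((k : ℝ) + 1) / a))) +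
          2 * ∑' k : ℕ,
            Real.log (1 + 2 / (Real.exp (a * ((k : ℝ) + 1) / ρ) - 1)) : ℝ) : ℂ) := by
  set A : ℝ := π ^ 2 / a ^ 2 with hAdef
  set C : ℝ := 1 / ρ ^ 2 with hCdef
  have hA : 0 < A := by positivity
  have hC : 0 < C := by positivity
  have h4A : 0 < 4 * A := mul_pos four_pos hA
  obtain ⟨f, hf, hfs⟩ := exists_continuation_spectralZeta hA hC
  set y : ℝ := π * ρ / a with hy
  have hy0 : 0 < y := by positivity
  have hsqrt : √(A / C) = y := by
    rw [Real.sqrt_eq_iff_mul_self_eq_of_pos hy0, hAdef, hCdef, hy]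
    field_simp
  have hL1 (k : ℕ) : 4 * π ^ 2 * ρ * ((k : ℝ) + 1) / a = 2 * π * (2 * y) * ((k : ℝ) + 1) := by
    rw [hy]
    ring
  have hL2 (k : ℕ) : a * ((k : ℝ) + 1) / ρ = 2 * π * (2 * y)⁻¹ * ((k : ℝ) + 1) := by
    rw [hy]
    field_simp
  have hodd := hasSum_log_one_add_two_div (inv_pos.mpr (mul_pos two_pos hy0))
  refine ⟨f, hf, fun s hs ↦ ?_, ?_, ?_, ?_⟩
  · have e2 (m : ℕ) : 4 * π ^ 2 * ((m : ℝ) + 1) ^ 2 / a ^ 2 = 4 * A * ((m : ℝ) + 1) ^ 2 := by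
      rw [hAdef]
      ring
    have e3 (m : ℕ) : ((m : ℝ) + 1) ^ 2 / ρ ^ 2 = C * ((m : ℝ) + 1) ^ 2 := by
      rw [hCdef]
      ring
    have e4 (m : ℕ) : 4 * π ^ 2 * ((m : ℝ) + 1 - 1 / 2) ^ 2 / a ^ 2 =
        A * (2 * (m : ℝ) + 1) ^ 2 := by
      rw [hAdef]
      ring
    simp only [e2, e3, e4]
    have s1 := summable_cpow_quadratic h4A hC hs
    have s2 := hasSum_mul_succ_sq_cpow h4A hs
    have s3 := hasSum_mul_succ_sq_cpow hC hs
    have s4 := hasSum_odd_quadratic_cpow hA hC hs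
    refine ⟨s1, s2.summable, s3.summable, s4.summable, ?_⟩
    rw [s2.tsum_eq, s3.tsum_eq, s4.tsum_eq, hfs s ?_, spectralZeta_eq hA hC hs, ← quadraticZeta]
    · ring
    · rintro rfl
      norm_num at hs
  · simp only [hL1]
    exact summable_log_one_sub_exp (mul_pos two_pos hy0)
  · simp only [hL2]
    exact hodd.summable
  · have hd : HasDerivAt f _ 0 := (hasDerivAt_spectralZeta_zero hA hC).congr_of_eventuallyEq (by
      filter_upwards [eventually_ne_nhds (by norm_num : (0 : ℂ) ≠ 1 / 2)] with s hs
      exact hfs s hs)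
    simp only [hL1, hL2]
    rw [hd.deriv, hodd.tsum_eq, ← logEtaProd, hsqrt, ← Complex.ofReal_neg]
    congr 1
    have i1 := logEtaProd_inv hy0
    have i2 := logEtaProd_inv (mul_pos two_pos hy0)
    have e : 2 * (2 * y)⁻¹ = y⁻¹ := by field_simp
    rw [e]
    have l1 : Real.log y = Real.log π + Real.log ρ - Real.log a := by
      rw [hy, Real.log_div (by positivity) ha.ne', Real.log_mul (by positivity) hρ.ne']
    have l2 : Real.log (2 * y) = Real.log 2 + Real.log y := Real.log_mul two_ne_zero hy0.ne'
    have l3 : Real.log A = 2 * Real.log π - 2 * Real.log a := by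
      rw [hAdef, Real.log_div (by positivity) (by positivity), Real.log_pow, Real.log_pow]
      norm_num
    have l4 : Real.log C = -(2 * Real.log ρ) := by
      rw [hCdef, one_div, Real.log_inv, Real.log_pow]
      norm_num
    have l5 : Real.log (4 * A) = 2 * Real.log 2 + Real.log A := by
      rw [Real.log_mul four_ne_zero hA.ne', show (4 : ℝ) = 2 ^ 2 by norm_num, Real.log_pow]
      norm_num
    have l6 : Real.log (2 * π) = Real.log 2 + Real.log π := Real.log_mul two_ne_zero pi_ne_zero
    have l7 : Real.log (2 * π * ρ) = Real.log 2 + Real.log π + Real.log ρ := by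
      rw [Real.log_mul (by positivity) hρ.ne', l6]
    have hy' : 2 * π ^ 2 * ρ / (3 * a) = 2 * π * y / 3 := by
      rw [hy]
      ring
    rw [mul_inv] at i2 ⊢
    rw [hy', l7, l6, l5, l4, l3]
    rw [l2] at i2
    linear_combination (-2 : ℝ) * i1 + 4 * i2 + l1
end

section
/- Let a > 0 and ρ > 0. Define, for complex s with Re s > 1, Z_D(s) = 2·∑_{m,n=1}^∞ (4π²(m - 1/2)²/a² + n²/ρ²)^{-s} - 2·∑_{m,n=1}^∞ (4π²m²/a² + n²/ρ²)^{-s} - ∑_{m=1}^∞ (m²/ρ²)^{-s}. Then there exists an entire function f : ℂ → ℂ with f(s) = Z_D(s) for all s with Re s > 1, and f'(0) = -2·∑_{k=1}^∞ log(1 + 2/(exp(ak/ρ) - 1)). -/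
open Real

open Set Filter Topology MeasureTheory Asymptotics HurwitzZeta

/-- Sums over a disjoint union of index types. -/
lemma HasSum.of_inl_inr {α β M : Type*} [AddCommMonoid M] [TopologicalSpace M] [ContinuousAdd M]
    {f : α ⊕ β → M} {x y : M} (hx : HasSum (fun i => f (Sum.inl i)) x)
    (hy : HasSum (fun i => f (Sum.inr i)) y) : HasSum f (x + y) :=
  HasSum.add_isCompl isCompl_range_inl_range_inr
    (Sum.inl_injective.hasSum_range_iff.2 hx) (Sum.inr_injective.hasSum_range_iff.2 hy)

lemma HasSum.mul_prod {α β : Type*} {f : α → ℝ} {g : β → ℝ} {x y : ℝ} (hf : HasSum f x)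
    (hg : HasSum g y) : HasSum (fun i : α × β => f i.1 * g i.2) (x * y) :=
  hf.mul hg (summable_mul_of_summable_norm hf.summable.norm hg.summable.norm)

section GaussianPrimitive

lemma hasDerivAt_gaussian_primitive (x : ℝ) :
    HasDerivAt (fun x : ℝ => ∫ y in (0 : ℝ)..x, rexp (-1 * y ^ 2)) (rexp (-1 * x ^ 2)) x :=
  ((show Continuous fun y : ℝ => rexp (-1 * y ^ 2) by fun_prop).integral_hasStrictDerivAt
    0 x).hasDerivAt

lemma tendsto_gaussian_primitive_atTop :
    Tendsto (fun x : ℝ => ∫ y in (0 : ℝ)..x, rexp (-1 * y ^ 2)) atTop (𝓝 (√π / 2)) := by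
  have h := intervalIntegral_tendsto_integral_Ioi (0 : ℝ)
    (integrable_exp_neg_mul_sq one_pos).integrableOn tendsto_id
  simpa only [integral_gaussian_Ioi, div_one, id] using h

lemma tendsto_gaussian_primitive_atBot :
    Tendsto (fun x : ℝ => ∫ y in (0 : ℝ)..x, rexp (-1 * y ^ 2)) atBot (𝓝 (-(√π / 2))) := by
  refine (tendsto_gaussian_primitive_atTop.comp tendsto_neg_atBot_atTop).neg.congr fun x => ?_
  have h := intervalIntegral.integral_comp_neg (a := 0) (b := x) fun y : ℝ => rexp (-1 * y ^ 2)
  simp only [neg_sq, neg_zero] at h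
  simp only [Function.comp_apply]
  rw [h, intervalIntegral.integral_symm, neg_neg]

end GaussianPrimitive

/-- The Bessel integral `∫ t^(-3/2) exp (-p² t - q² / t)` together with its convergence. -/
lemma integrableOn_and_integral_inv_mul_exp {p q : ℝ} (hp : 0 < p) (hq : 0 < q) :
    IntegrableOn (fun t => (t * √t)⁻¹ * rexp (-(p ^ 2 * t + q ^ 2 / t))) (Ioi 0) ∧
      ∫ t in Ioi 0, (t * √t)⁻¹ * rexp (-(p ^ 2 * t + q ^ 2 / t)) =
        √π / q * rexp (-(2 * p * q)) := by
  set Φ : ℝ → ℝ := fun x => ∫ y in (0 : ℝ)..x, rexp (-1 * y ^ 2) with hΦ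
  set g : ℝ → ℝ := fun t => q⁻¹ * (rexp (-(2 * p * q)) * Φ (p * √t - q * (√t)⁻¹) -
    rexp (2 * p * q) * Φ (p * √t + q * (√t)⁻¹)) with hg
  set g' : ℝ → ℝ := fun t => (t * √t)⁻¹ * rexp (-(p ^ 2 * t + q ^ 2 / t)) with hg'
  have hderiv : ∀ t ∈ Ioi (0 : ℝ), HasDerivAt g (g' t) t := by
    intro t (ht : 0 < t)
    have hs : 0 < √t := Real.sqrt_pos.2 ht
    have hsq : √t ^ 2 = t := Real.sq_sqrt ht.le
    have d1 : HasDerivAt (fun t => √t) (1 / (2 * √t)) t := Real.hasDerivAt_sqrt ht.ne'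
    have d2 := d1.inv hs.ne'
    have d3 := (hasDerivAt_gaussian_primitive (p * √t - q * (√t)⁻¹)).comp t
      ((d1.const_mul p).sub (d2.const_mul q))
    have d4 := (hasDerivAt_gaussian_primitive (p * √t + q * (√t)⁻¹)).comp t
      ((d1.const_mul p).add (d2.const_mul q))
    have d5 := ((d3.const_mul (rexp (-(2 * p * q)))).sub
      (d4.const_mul (rexp (2 * p * q)))).const_mul q⁻¹
    refine d5.congr_deriv ?_
    have e1 : rexp (-1 * (p * √t - q * (√t)⁻¹) ^ 2) =
        rexp (2 * p * q) * rexp (-(p ^ 2 * t + q ^ 2 / t)) := by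
      rw [← Real.exp_add]; congr 1
      rw [← hsq, Real.sqrt_sq hs.le]; field_simp; ring
    have e2 : rexp (-1 * (p * √t + q * (√t)⁻¹) ^ 2) =
        rexp (-(2 * p * q)) * rexp (-(p ^ 2 * t + q ^ 2 / t)) := by
      rw [← Real.exp_add]; congr 1
      rw [← hsq, Real.sqrt_sq hs.le]; field_simp; ring
    have e3 : rexp (2 * p * q) ≠ 0 := (Real.exp_pos _).ne'
    rw [e1, e2, hg']
    simp only [Real.exp_neg (2 * p * q)]
    rw [show t * √t = √t ^ 2 * √t by rw [hsq]]
    field_simp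
    ring
  have hnonneg : ∀ t ∈ Ioi (0 : ℝ), 0 ≤ g' t := fun t (ht : 0 < t) => by
    simp only [hg']; positivity
  have hsqrt : Tendsto (fun t : ℝ => √t) atTop atTop := Real.tendsto_sqrt_atTop
  have hinv : Tendsto (fun t : ℝ => q * (√t)⁻¹) atTop (𝓝 0) := by
    simpa using (tendsto_inv_atTop_zero.comp hsqrt).const_mul q
  have htop : Tendsto g atTop (𝓝 (q⁻¹ * (rexp (-(2 * p * q)) * (√π / 2) -
      rexp (2 * p * q) * (√π / 2)))) := by
    refine (((tendsto_gaussian_primitive_atTop.comp ?_).const_mul _).sub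
      ((tendsto_gaussian_primitive_atTop.comp ?_).const_mul _)).const_mul _
    · simpa [sub_eq_add_neg] using (hsqrt.const_mul_atTop hp).atTop_add hinv.neg
    · exact (hsqrt.const_mul_atTop hp).atTop_add hinv
  have hsqrt0 : Tendsto (fun t : ℝ => √t) (𝓝[>] 0) (𝓝[>] 0) := by
    refine tendsto_nhdsWithin_iff.2 ⟨?_, ?_⟩
    · simpa using (Real.continuous_sqrt.tendsto 0).mono_left nhdsWithin_le_nhds
    · filter_upwards [self_mem_nhdsWithin] with t ht using Real.sqrt_pos.2 ht
  have hsqrt0' : Tendsto (fun t : ℝ => p * √t) (𝓝[>] 0) (𝓝 0) := by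
    simpa using (hsqrt0.mono_right nhdsWithin_le_nhds).const_mul p
  have hinv0 : Tendsto (fun t : ℝ => q * (√t)⁻¹) (𝓝[>] 0) atTop :=
    (tendsto_inv_nhdsGT_zero.comp hsqrt0).const_mul_atTop hq
  have hzero : Tendsto g (𝓝[>] 0) (𝓝 (q⁻¹ * (rexp (-(2 * p * q)) * (-(√π / 2)) -
      rexp (2 * p * q) * (√π / 2)))) := by
    refine (((tendsto_gaussian_primitive_atBot.comp ?_).const_mul _).sub
      ((tendsto_gaussian_primitive_atTop.comp ?_).const_mul _)).const_mul _
    · simpa [sub_eq_add_neg] using hsqrt0'.add_atBot (tendsto_neg_atTop_atBot.comp hinv0)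
    · exact hsqrt0'.add_atTop hinv0
  set l := q⁻¹ * (rexp (-(2 * p * q)) * (-(√π / 2)) - rexp (2 * p * q) * (√π / 2)) with hl
  have hcont : ContinuousWithinAt (Function.update g 0 l) (Ici 0) 0 := by
    rw [continuousWithinAt_update_same, Ici_sdiff_left]
    exact hzero
  have hne : ∀ t : ℝ, 0 < t → Function.update g 0 l =ᶠ[𝓝 t] g := fun t ht => by
    filter_upwards [eventually_ne_nhds ht.ne'] with x hx using Function.update_of_ne hx _ _
  have hderiv' : ∀ t ∈ Ioi (0 : ℝ), HasDerivAt (Function.update g 0 l) (g' t) t :=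
    fun t ht => (hderiv t ht).congr_of_eventuallyEq (hne t ht)
  have htop' := htop.congr' (f₂ := Function.update g 0 l) (by
    filter_upwards [eventually_ne_atTop 0] with x hx using (Function.update_of_ne hx _ _).symm)
  refine ⟨integrableOn_Ioi_deriv_of_nonneg hcont hderiv' hnonneg htop', ?_⟩
  rw [integral_Ioi_of_hasDerivAt_of_nonneg hcont hderiv' hnonneg htop', Function.update_self, hl]
  ring

section Kernels

lemma hasSum_nat_evenKernel_zero {t : ℝ} (ht : 0 < t) :
    HasSum (fun n : ℕ => rexp (-π * ((n : ℝ) + 1) ^ 2 * t)) ((evenKernel 0 t - 1) / 2) := by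
  have h := (hasSum_nat_cosKernel₀ 0 ht).div_const 2
  rw [QuotientAddGroup.mk_zero, ← evenKernel_eq_cosKernel_of_zero] at h
  simpa using h

lemma hasSum_nat_evenKernel_half {t : ℝ} (ht : 0 < t) :
    HasSum (fun m : ℕ => 2 * rexp (-π * ((m : ℝ) + 1 / 2) ^ 2 * t))
      (evenKernel ((1 / 2 : ℝ) : UnitAddCircle) t) := by
  refine (hasSum_int_evenKernel (1 / 2) ht).nat_add_neg_add_one.congr_fun fun m => ?_
  push_cast
  rw [two_mul]
  congr 3
  ring

lemma hasSum_nat_evenKernel_half_sub_zero {t : ℝ} (ht : 0 < t) :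
    HasSum (fun k : ℕ => (√t)⁻¹ * (2 * ((-1) ^ (k + 1) - 1) *
        rexp (-π * ((k : ℝ) + 1) ^ 2 * t⁻¹)))
      (evenKernel ((1 / 2 : ℝ) : UnitAddCircle) t - evenKernel 0 t) := by
  have h := ((hasSum_nat_cosKernel₀ (1 / 2) (inv_pos.2 ht)).sub
    (hasSum_nat_cosKernel₀ 0 (inv_pos.2 ht))).mul_left (√t)⁻¹
  rw [evenKernel_functional_equation, evenKernel_functional_equation 0, ← mul_sub, one_div t,
    ← Real.sqrt_eq_rpow, one_div (√t)]
  convert! h using 1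
  · ext k
    rw [show 2 * π * (1 / 2) * ((k : ℝ) + 1) = ((k + 1 : ℕ) : ℝ) * π by push_cast; ring,
      Real.cos_nat_mul_pi]
    simp only [mul_zero, zero_mul, Real.cos_zero]
    ring
  · simp

lemma evenKernel_sub_isBigO_rpow (a : UnitAddCircle) (r : ℝ) :
    (fun x => evenKernel a x - if a = 0 then 1 else 0) =O[atTop] fun x => x ^ r := by
  obtain ⟨p, hp, h⟩ := isBigO_atTop_evenKernel_sub a
  exact h.trans (isLittleO_exp_neg_mul_rpow_atTop hp r).isBigO

lemma cosKernel_sub_isBigO_rpow (a : UnitAddCircle) (r : ℝ) :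
    (fun x => cosKernel a x - 1) =O[atTop] fun x => x ^ r := by
  obtain ⟨p, hp, h⟩ := isBigO_atTop_cosKernel_sub a
  exact h.trans (isLittleO_exp_neg_mul_rpow_atTop hp r).isBigO

lemma evenKernel_isBigO_one (a : UnitAddCircle) :
    evenKernel a =O[atTop] fun _ => (1 : ℝ) := by
  have h := (show _ =O[atTop] fun _ => (1 : ℝ) by
    simpa using evenKernel_sub_isBigO_rpow a 0).add
      ((isBigO_refl (fun _ => (1 : ℝ)) atTop).const_mul_left
      (if a = 0 then (1 : ℝ) else 0))
  simpa using h

lemma Asymptotics.IsBigO.comp_const_mul_rpow {f : ℝ → ℝ} {r c : ℝ} (hc : 0 < c)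
    (h : f =O[atTop] fun x => x ^ r) : (fun x => f (c * x)) =O[atTop] fun x => x ^ r := by
  refine (h.comp_tendsto (tendsto_id.const_mul_atTop hc)).trans ?_
  refine ((isBigO_refl (fun x : ℝ => x ^ r) atTop).const_mul_left (c ^ r)).congr' ?_ .rfl
  filter_upwards [eventually_gt_atTop 0] with x hx
  simp [Real.mul_rpow hc.le hx.le]

end Kernels

/-- The difference of the traces of the heat kernels, with the scales of the two circles
normalised. -/
noncomputable def heatDiff (A B t : ℝ) : ℝ :=
  (evenKernel 0 (A * t) - 1) / 2 *
    (evenKernel ((1 / 2 : ℝ) : UnitAddCircle) (B * t) - evenKernel 0 (B * t))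

section HeatDiff

variable {A B : ℝ}

lemma continuousOn_heatDiff (hA : 0 < A) (hB : 0 < B) : ContinuousOn (heatDiff A B) (Ioi 0) := by
  have key : ∀ {c : ℝ} (a : UnitAddCircle), 0 < c →
      ContinuousOn (fun t => evenKernel a (c * t)) (Ioi 0) := fun a hc =>
    (continuousOn_evenKernel a).comp (by fun_prop) fun t (ht : 0 < t) => mul_pos hc ht
  exact (((key 0 hA).sub continuousOn_const).div_const 2).mul ((key _ hB).sub (key 0 hB))

lemma heatDiff_isBigO_atTop (hA : 0 < A) (hB : 0 < B) (r : ℝ) :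
    heatDiff A B =O[atTop] fun t => t ^ r := by
  have h1 : (fun t => (evenKernel 0 (A * t) - 1) / 2) =O[atTop] fun t => t ^ r := by
    have h := (evenKernel_sub_isBigO_rpow 0 r).comp_const_mul_rpow hA
    simpa [div_eq_inv_mul] using h.const_mul_left 2⁻¹
  have h2 := ((evenKernel_isBigO_one ((1 / 2 : ℝ) : UnitAddCircle)).sub
    (evenKernel_isBigO_one 0)).comp_tendsto (tendsto_id.const_mul_atTop hB)
  exact (h1.mul h2).congr (fun _ => rfl) fun _ => mul_one _

lemma heatDiff_isBigO_zero (hA : 0 < A) (hB : 0 < B) (r : ℝ) :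
    heatDiff A B =O[𝓝[>] 0] fun t => t ^ r := by
  suffices h : (fun x => heatDiff A B x⁻¹) =O[atTop] fun x => x ^ (-r) by
    refine (h.comp_tendsto tendsto_inv_nhdsGT_zero).congr' (.of_eq ?_) ?_
    · ext t; simp
    · filter_upwards [self_mem_nhdsWithin] with t (ht : 0 < t)
      simp [Real.inv_rpow ht.le, Real.rpow_neg ht.le]
  have hfe : ∀ {c : ℝ} (a : UnitAddCircle), 0 < c → ∀ᶠ x in atTop,
      evenKernel a (c * x⁻¹) = (√c)⁻¹ * x ^ (1 / 2 : ℝ) * cosKernel a (c⁻¹ * x) := by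
    intro c a hc
    filter_upwards [eventually_gt_atTop 0] with x hx
    rw [evenKernel_functional_equation, ← Real.sqrt_eq_rpow, ← Real.sqrt_eq_rpow,
      Real.sqrt_mul hc.le, Real.sqrt_inv, one_div, one_div, mul_inv, mul_inv, inv_inv, inv_inv]
  have hpow : (fun _ : ℝ => (1 : ℝ)) =O[atTop] fun x => x ^ (1 / 2 : ℝ) := by
    refine IsBigO.of_bound 1 ?_
    filter_upwards [eventually_ge_atTop 1] with x hx
    rw [one_mul, norm_one, Real.norm_of_nonneg (by positivity)]
    exact Real.one_le_rpow hx (by norm_num)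
  have hcos : (fun x => cosKernel 0 (A⁻¹ * x)) =O[atTop] fun _ => (1 : ℝ) := by
    rw [← evenKernel_eq_cosKernel_of_zero]
    exact (evenKernel_isBigO_one 0).comp_tendsto (tendsto_id.const_mul_atTop (inv_pos.2 hA))
  have h1 : (fun x => (evenKernel 0 (A * x⁻¹) - 1) / 2) =O[atTop] fun x => x ^ (1 / 2 : ℝ) := by
    have h : (fun x => evenKernel 0 (A * x⁻¹)) =O[atTop] fun x => x ^ (1 / 2 : ℝ) := by
      refine IsBigO.congr' ?_ ((hfe 0 hA).mono fun x hx => hx.symm) .rfl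
      simpa using ((isBigO_refl (fun x : ℝ => x ^ (1 / 2 : ℝ)) atTop).const_mul_left
        (√A)⁻¹).mul hcos
    simpa [div_eq_inv_mul] using (h.sub hpow).const_mul_left 2⁻¹
  have h2 : (fun x => evenKernel ((1 / 2 : ℝ) : UnitAddCircle) (B * x⁻¹) -
      evenKernel 0 (B * x⁻¹)) =O[atTop] fun x => x ^ (1 / 2 : ℝ) * x ^ (-r - 1) := by
    have h := ((cosKernel_sub_isBigO_rpow ((1 / 2 : ℝ) : UnitAddCircle) (-r - 1)).sub
      (cosKernel_sub_isBigO_rpow 0 (-r - 1))).comp_const_mul_rpow (inv_pos.2 hB)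
    refine (((isBigO_refl (fun x : ℝ => x ^ (1 / 2 : ℝ)) atTop).const_mul_left
      (√B)⁻¹).mul h).congr' ?_ .rfl
    filter_upwards [hfe ((1 / 2 : ℝ) : UnitAddCircle) hB, hfe 0 hB] with x hx hx'
    rw [hx, hx']
    ring
  refine (h1.mul h2).congr' .rfl ?_
  filter_upwards [eventually_gt_atTop 0] with x hx
  rw [← Real.rpow_add hx, ← Real.rpow_add hx]
  congr 1
  ring

lemma differentiable_mellin_heatDiff (hA : 0 < A) (hB : 0 < B) :
    Differentiable ℂ (mellin fun t => (heatDiff A B t : ℂ)) := fun s => by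
  refine mellin_differentiableAt_of_isBigO_rpow (a := s.re + 1) (b := s.re - 1) ?_ ?_
    (by linarith) ?_ (by linarith)
  · exact (Complex.continuous_ofReal.comp_continuousOn
      (continuousOn_heatDiff hA hB)).locallyIntegrableOn measurableSet_Ioi
  · exact Complex.isBigO_ofReal_left.2 (heatDiff_isBigO_atTop hA hB _)
  · exact Complex.isBigO_ofReal_left.2 (heatDiff_isBigO_zero hA hB _)

end HeatDiff

section ValueAtZero

lemma hasSum_log_fiber {z : ℝ} (hz : 0 < z) :
    HasSum (fun k : ℕ => 2 * ((-1) ^ (k + 1) - 1) / ((k : ℝ) + 1) * rexp (-(z * ((k : ℝ) + 1))))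
      (-2 * Real.log (1 + 2 / (rexp z - 1))) := by
  have h1 : rexp (-z) < 1 := by simpa using hz
  have h0 : 0 < rexp (-z) := Real.exp_pos _
  have hz1 : 1 < rexp z := Real.one_lt_exp_iff.2 hz
  have hx : |rexp (-z)| < 1 := by rwa [abs_of_pos h0]
  have hneg := Real.hasSum_pow_div_log_of_abs_lt_one (x := -rexp (-z)) (by rwa [abs_neg])
  have h := (hneg.sub (Real.hasSum_pow_div_log_of_abs_lt_one hx)).mul_left 2
  convert! h using 1
  · ext k
    rw [show -(z * ((k : ℝ) + 1)) = ((k + 1 : ℕ) : ℝ) * -z by push_cast; ring, Real.exp_nat_mul,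
      neg_pow (rexp (-z))]
    ring
  · simp only [sub_neg_eq_add]
    rw [show 1 + 2 / (rexp z - 1) = (1 + rexp (-z)) / (1 - rexp (-z)) by
      have : rexp z - 1 ≠ 0 := by linarith
      have : 1 - rexp (-z) ≠ 0 := by linarith
      rw [Real.exp_neg] at *
      field_simp
      ring, Real.log_div (by linarith) (by linarith)]
    ring

lemma summable_exp_neg_mul_mul {y : ℝ} (hy : 0 < y) :
    Summable fun i : ℕ × ℕ => rexp (-(y * ((i.1 : ℝ) + 1) * ((i.2 : ℝ) + 1))) := by
  have h : Summable fun n : ℕ => rexp (-y * n) := by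
    simpa [mul_comm] using Real.summable_exp_nat_mul_iff.2 (neg_lt_zero.2 hy)
  have hp := h.mul_of_nonneg h (fun _ => (Real.exp_pos _).le) fun _ => (Real.exp_pos _).le
  refine hp.of_nonneg_of_le
    (fun _ => (Real.exp_pos _).le) fun i => ?_
  rw [← Real.exp_add, Real.exp_le_exp]
  have h1 : (0 : ℝ) ≤ i.1 := i.1.cast_nonneg
  have h2 : (0 : ℝ) ≤ i.2 := i.2.cast_nonneg
  nlinarith [mul_nonneg hy.le (mul_nonneg h1 h2)]

variable {A B : ℝ}

lemma hasSum_heatDiff (hA : 0 < A) (hB : 0 < B) {t : ℝ} (ht : 0 < t) :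
    HasSum (fun i : ℕ × ℕ => 2 * ((-1) ^ (i.2 + 1) - 1) / √B * ((t * √t)⁻¹ *
        rexp (-((√(π * A) * ((i.1 : ℝ) + 1)) ^ 2 * t + (√(π / B) * ((i.2 : ℝ) + 1)) ^ 2 / t))))
      (t⁻¹ * heatDiff A B t) := by
  have h1 := hasSum_nat_evenKernel_zero (mul_pos hA ht)
  have h2 := hasSum_nat_evenKernel_half_sub_zero (mul_pos hB ht)
  have h := (h1.mul_prod h2).mul_left t⁻¹
  refine h.congr_fun fun i => ?_
  rw [mul_pow, mul_pow, Real.sq_sqrt (by positivity), Real.sq_sqrt (by positivity), neg_add,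
    Real.exp_add, Real.sqrt_mul hB.le]
  rw [show -(π * A * ((i.1 : ℝ) + 1) ^ 2 * t) = -π * ((i.1 : ℝ) + 1) ^ 2 * (A * t) by ring,
    show -(π / B * ((i.2 : ℝ) + 1) ^ 2 / t) = -π * ((i.2 : ℝ) + 1) ^ 2 * (B * t)⁻¹ by
      field_simp]
  field_simp

lemma hasSum_integral_heatDiff (hA : 0 < A) (hB : 0 < B) :
    HasSum (fun i : ℕ × ℕ => 2 * ((-1) ^ (i.2 + 1) - 1) / ((i.2 : ℝ) + 1) *
        rexp (-(2 * π * √(A / B) * ((i.1 : ℝ) + 1) * ((i.2 : ℝ) + 1))))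
      (∫ t in Ioi 0, t⁻¹ * heatDiff A B t) := by
  have key : ∀ i : ℕ × ℕ, _ := fun i => integrableOn_and_integral_inv_mul_exp
    (p := √(π * A) * ((i.1 : ℝ) + 1)) (q := √(π / B) * ((i.2 : ℝ) + 1))
    (by positivity) (by positivity)
  have hval : ∀ i : ℕ × ℕ, ∀ c : ℝ, c / √B * (√π / (√(π / B) * ((i.2 : ℝ) + 1)) *
      rexp (-(2 * (√(π * A) * ((i.1 : ℝ) + 1)) * (√(π / B) * ((i.2 : ℝ) + 1))))) =
      c / ((i.2 : ℝ) + 1) *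
        rexp (-(2 * π * √(A / B) * ((i.1 : ℝ) + 1) * ((i.2 : ℝ) + 1))) := by
    intro i c
    have hpi : √π ^ 2 = π := Real.sq_sqrt pi_pos.le
    have : (2 * (√(π * A) * ((i.1 : ℝ) + 1)) * (√(π / B) * ((i.2 : ℝ) + 1))) =
        2 * π * √(A / B) * ((i.1 : ℝ) + 1) * ((i.2 : ℝ) + 1) := by
      rw [Real.sqrt_mul pi_pos.le, Real.sqrt_div pi_pos.le, Real.sqrt_div hA.le]
      linear_combination (2 * √A / √B * ((i.1 : ℝ) + 1) * ((i.2 : ℝ) + 1)) * hpi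
    rw [this, Real.sqrt_div pi_pos.le]
    field_simp
  have h := hasSum_integral_of_summable_integral_norm (μ := volume.restrict (Ioi 0))
    (fun i : ℕ × ℕ => (key i).1.const_mul (2 * ((-1) ^ (i.2 + 1) - 1) / √B)) ?_
  · rw [setIntegral_congr_fun measurableSet_Ioi
      fun t ht => (hasSum_heatDiff hA hB ht).tsum_eq] at h
    refine h.congr_fun fun i => ?_
    rw [integral_const_mul, (key i).2, hval]
  · have hnorm : ∀ i : ℕ × ℕ, ∫ t in Ioi 0, ‖2 * ((-1) ^ (i.2 + 1) - 1) / √B * ((t * √t)⁻¹ *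
        rexp (-((√(π * A) * ((i.1 : ℝ) + 1)) ^ 2 * t +
          (√(π / B) * ((i.2 : ℝ) + 1)) ^ 2 / t)))‖ =
        |2 * ((-1) ^ (i.2 + 1) - 1)| / ((i.2 : ℝ) + 1) *
          rexp (-(2 * π * √(A / B) * ((i.1 : ℝ) + 1) * ((i.2 : ℝ) + 1))) := by
      intro i
      rw [← hval, ← (key i).2, ← integral_const_mul]
      refine setIntegral_congr_fun measurableSet_Ioi fun t (ht : 0 < t) => ?_
      simp only [norm_mul, norm_div, Real.norm_eq_abs, Real.abs_exp, abs_mul, abs_inv,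
        abs_of_pos ht, abs_of_nonneg (Real.sqrt_nonneg _)]
    simp_rw [hnorm]
    refine ((summable_exp_neg_mul_mul (y := 2 * π * √(A / B)) (by positivity)).mul_left
      4).of_nonneg_of_le (fun i => by positivity) fun i => ?_
    refine mul_le_mul_of_nonneg_right ?_ (Real.exp_pos _).le
    have h4 : |2 * ((-1 : ℝ) ^ (i.2 + 1) - 1)| ≤ 4 := by
      rcases neg_one_pow_eq_or ℝ (i.2 + 1) with h | h <;> rw [h] <;> norm_num
    refine (div_le_self (abs_nonneg _) ?_).trans h4
    linarith [(Nat.cast_nonneg i.2 : (0 : ℝ) ≤ i.2)]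

lemma hasSum_log_integral_heatDiff (hA : 0 < A) (hB : 0 < B) :
    HasSum (fun k : ℕ =>
        -2 * Real.log (1 + 2 / (rexp (2 * π * √(A / B) * ((k : ℝ) + 1)) - 1)))
      (∫ t in Ioi 0, t⁻¹ * heatDiff A B t) :=
  (hasSum_integral_heatDiff hA hB).prod_fiberwise fun n =>
    hasSum_log_fiber (z := 2 * π * √(A / B) * ((n : ℝ) + 1)) (by positivity)

lemma mellin_heatDiff_zero :
    mellin (fun t => (heatDiff A B t : ℂ)) 0 = ((∫ t in Ioi 0, t⁻¹ * heatDiff A B t : ℝ) : ℂ) := by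
  rw [mellin, ← integral_complex_ofReal]
  refine integral_congr_ae (.of_forall fun t => ?_)
  simp [Complex.cpow_neg_one]

end ValueAtZero

section DirichletSeries

lemma summable_one_div_quadratic_rpow {u v δ σ : ℝ} (hu : 0 < u) (hv : 0 < v) (hδ : 0 < δ)
    (hδ1 : δ ≤ 1) (hσ : 1 < σ) : Summable fun p : ℕ × ℕ =>
      1 / (u * ((p.1 : ℝ) + δ) ^ 2 + v * ((p.2 : ℝ) + 1) ^ 2) ^ σ := by
  have h : Summable fun n : ℕ => (((n : ℝ) + 1) ^ σ)⁻¹ := by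
    simpa using (summable_nat_add_iff 1).2 (Real.summable_nat_rpow_inv.2 hσ)
  refine ((h.mul_of_nonneg h (fun _ => by positivity) fun _ => by positivity).mul_left
    ((2 * √u * √v * δ) ^ σ)⁻¹).of_nonneg_of_le (fun _ => by positivity) fun p => ?_
  rw [one_div, ← mul_inv, ← mul_inv, ← Real.mul_rpow (by positivity) (by positivity),
    ← Real.mul_rpow (by positivity) (by positivity)]
  refine inv_anti₀ (by positivity) (Real.rpow_le_rpow (by positivity) ?_ (by linarith))
  have hm : δ * ((p.1 : ℝ) + 1) ≤ p.1 + δ := by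
    nlinarith [(Nat.cast_nonneg p.1 : (0 : ℝ) ≤ p.1)]
  have hu' := Real.sq_sqrt hu.le
  have hv' := Real.sq_sqrt hv.le
  calc 2 * √u * √v * δ * (((p.1 : ℝ) + 1) * ((p.2 : ℝ) + 1))
      = 2 * √u * √v * ((p.2 : ℝ) + 1) * (δ * ((p.1 : ℝ) + 1)) := by ring
    _ ≤ 2 * √u * √v * ((p.2 : ℝ) + 1) * (p.1 + δ) := by gcongr
    _ ≤ (√u * ((p.1 : ℝ) + δ)) ^ 2 + (√v * ((p.2 : ℝ) + 1)) ^ 2 := by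
      nlinarith [sq_nonneg (√u * ((p.1 : ℝ) + δ) - √v * ((p.2 : ℝ) + 1))]
    _ = u * ((p.1 : ℝ) + δ) ^ 2 + v * ((p.2 : ℝ) + 1) ^ 2 := by
      rw [mul_pow, mul_pow, hu', hv']

lemma summable_one_div_mul_sq_rpow {v σ : ℝ} (hv : 0 < v) (hσ : 1 < σ) :
    Summable fun m : ℕ => 1 / (v * ((m : ℝ) + 1) ^ 2) ^ σ := by
  have h : Summable fun n : ℕ => (((n : ℝ) + 1) ^ σ)⁻¹ := by
    simpa using (summable_nat_add_iff 1).2 (Real.summable_nat_rpow_inv.2 hσ)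
  refine (h.mul_left (v ^ σ)⁻¹).of_nonneg_of_le (fun _ => by positivity) fun m => ?_
  rw [one_div, ← mul_inv, ← Real.mul_rpow (by positivity) (by positivity)]
  refine inv_anti₀ (by positivity) (Real.rpow_le_rpow (by positivity) ?_ (by linarith))
  gcongr
  nlinarith [(Nat.cast_nonneg m : (0 : ℝ) ≤ m)]

lemma Complex.summable_cpow_neg_of_one_div_rpow {ι : Type*} {p : ι → ℝ} (hp : ∀ i, 0 < p i) {s : ℂ}
    (h : Summable fun i => 1 / p i ^ s.re) : Summable fun i => (p i : ℂ) ^ (-s) := by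
  refine .of_norm (h.congr fun i => ?_)
  rw [Complex.norm_cpow_eq_rpow_re_of_pos (hp i), Complex.neg_re, Real.rpow_neg (hp i).le, one_div]

variable {u v : ℝ} {s : ℂ}

lemma hasSum_heatDiff_exp (hu : 0 < u) (hv : 0 < v) {t : ℝ} (ht : 0 < t) :
    HasSum (Sum.elim
        (fun p : ℕ × ℕ => 2 * rexp (-(u * ((p.1 : ℝ) + 1 / 2) ^ 2 + v * ((p.2 : ℝ) + 1) ^ 2) * t))
        (Sum.elim
          (fun p : ℕ × ℕ => -2 * rexp (-(u * ((p.1 : ℝ) + 1) ^ 2 + v * ((p.2 : ℝ) + 1) ^ 2) * t))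
          fun m : ℕ => -1 * rexp (-(v * ((m : ℝ) + 1) ^ 2) * t)))
        (heatDiff (v / π) (u / π) t) := by
  have hexp : ∀ w x : ℝ, rexp (-π * x ^ 2 * (w / π * t)) = rexp (-(w * x ^ 2) * t) := fun w x => by
    congr 1
    field_simp
  have hθ := hasSum_nat_evenKernel_zero (t := v / π * t) (by positivity)
  have hθ' := hasSum_nat_evenKernel_zero (t := u / π * t) (by positivity)
  have hη := hasSum_nat_evenKernel_half (t := u / π * t) (by positivity)
  simp only [hexp] at hθ hθ' hη
  have h1 := hη.mul_prod hθ
  have h2 := (hθ'.mul_left (-2)).mul_prod hθ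
  have h3 := hθ.mul_left (-1)
  simp only [mul_assoc, ← Real.exp_add, ← add_mul, ← neg_add] at h1 h2
  have h := h1.of_inl_inr (f := Sum.elim _ _) (h2.of_inl_inr (f := Sum.elim _ _) h3)
  rw [heatDiff]
  convert! h using 1
  ring

lemma hasSum_mellin_heatDiff (hu : 0 < u) (hv : 0 < v) (hs : 1 < s.re) :
    HasSum (Sum.elim
        (fun p : ℕ × ℕ => Complex.Gamma s * (2 : ℂ) /
          ((u * ((p.1 : ℝ) + 1 / 2) ^ 2 + v * ((p.2 : ℝ) + 1) ^ 2 : ℝ) : ℂ) ^ s)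
        (Sum.elim
          (fun p : ℕ × ℕ => Complex.Gamma s * (-2 : ℂ) /
            ((u * ((p.1 : ℝ) + 1) ^ 2 + v * ((p.2 : ℝ) + 1) ^ 2 : ℝ) : ℂ) ^ s)
          (fun m : ℕ => Complex.Gamma s * (-1 : ℂ) / ((v * ((m : ℝ) + 1) ^ 2 : ℝ) : ℂ) ^ s)))
      (mellin (fun t => (heatDiff (v / π) (u / π) t : ℂ)) s) := by
  set c : (ℕ × ℕ) ⊕ ((ℕ × ℕ) ⊕ ℕ) → ℂ :=
    Sum.elim (fun _ => 2) (Sum.elim (fun _ => -2) fun _ => -1) with hc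
  set P : (ℕ × ℕ) ⊕ ((ℕ × ℕ) ⊕ ℕ) → ℝ :=
    Sum.elim (fun p => u * ((p.1 : ℝ) + 1 / 2) ^ 2 + v * ((p.2 : ℝ) + 1) ^ 2)
      (Sum.elim (fun p => u * ((p.1 : ℝ) + 1) ^ 2 + v * ((p.2 : ℝ) + 1) ^ 2)
        fun m => v * ((m : ℝ) + 1) ^ 2) with hP
  have hpos : ∀ i, 0 < P i := by
    rintro (p | p | m) <;> simp only [hP, Sum.elim_inl, Sum.elim_inr] <;> positivity
  have h := hasSum_mellin (a := c) (p := P) (F := fun t => (heatDiff (v / π) (u / π) t : ℂ))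
    (s := s) (fun i => .inr (hpos i)) (by linarith) ?_ ?_
  · refine h.congr_fun ?_
    rintro (p | p | m) <;> rfl
  · intro t (ht : 0 < t)
    refine (Complex.hasSum_ofReal.2 (hasSum_heatDiff_exp hu hv ht)).congr_fun ?_
    rintro (p | p | m) <;> simp only [hc, hP, Sum.elim_inl, Sum.elim_inr] <;> push_cast <;> rfl
  · refine (HasSum.of_inl_inr (f := fun i => ‖c i‖ / P i ^ s.re)
      (Summable.hasSum ?_) (HasSum.of_inl_inr (Summable.hasSum ?_)
        (Summable.hasSum ?_))).summable
    · simpa [hc, hP, div_eq_mul_inv] using! (summable_one_div_quadratic_rpow hu hv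
        (δ := 1 / 2) (by norm_num) (by norm_num) hs).mul_left 2
    · simpa [hc, hP, div_eq_mul_inv] using! (summable_one_div_quadratic_rpow hu hv
        one_pos le_rfl hs).mul_left 2
    · simpa [hc, hP, div_eq_mul_inv] using! summable_one_div_mul_sq_rpow hv hs

lemma mellin_heatDiff_eq (hu : 0 < u) (hv : 0 < v) (hs : 1 < s.re) :
    mellin (fun t => (heatDiff (v / π) (u / π) t : ℂ)) s = Complex.Gamma s *
      (2 * ∑' p : ℕ × ℕ,
          ((u * ((p.1 : ℝ) + 1 / 2) ^ 2 + v * ((p.2 : ℝ) + 1) ^ 2 : ℝ) : ℂ) ^ (-s) -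
        2 * ∑' p : ℕ × ℕ, ((u * ((p.1 : ℝ) + 1) ^ 2 + v * ((p.2 : ℝ) + 1) ^ 2 : ℝ) : ℂ) ^ (-s) -
        ∑' m : ℕ, ((v * ((m : ℝ) + 1) ^ 2 : ℝ) : ℂ) ^ (-s)) := by
  have h1 := (Complex.summable_cpow_neg_of_one_div_rpow (fun _ => by positivity)
    (summable_one_div_quadratic_rpow hu hv (δ := 1 / 2) (by norm_num) (by norm_num) hs)).hasSum
  have h2 := (Complex.summable_cpow_neg_of_one_div_rpow (fun _ => by positivity)
    (summable_one_div_quadratic_rpow hu hv one_pos le_rfl hs)).hasSum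
  have h3 := (Complex.summable_cpow_neg_of_one_div_rpow (fun _ => by positivity)
    (summable_one_div_mul_sq_rpow hv hs)).hasSum
  refine (hasSum_mellin_heatDiff hu hv hs).unique ?_
  convert! HasSum.of_inl_inr ((h1.mul_left (Complex.Gamma s * 2)).congr_fun fun p => ?_)
    (HasSum.of_inl_inr ((h2.mul_left (Complex.Gamma s * -2)).congr_fun fun p => ?_)
      ((h3.mul_left (Complex.Gamma s * -1)).congr_fun fun m => ?_)) using 1
  · ring
  all_goals simp only [Sum.elim_inl, Sum.elim_inr, Complex.cpow_neg, div_eq_mul_inv]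

end DirichletSeries

lemma Complex.hasDerivAt_mul_inv_Gamma_zero {M : ℂ → ℂ} (hM : DifferentiableAt ℂ M 0) :
    HasDerivAt (fun s => M s * (Complex.Gamma s)⁻¹) (M 0) 0 := by
  have hG : DifferentiableAt ℂ (fun s : ℂ => (Complex.Gamma (s + 1))⁻¹) 0 :=
    (Complex.differentiable_one_div_Gamma.comp (differentiable_id.add_const 1)) 0
  have h := (hasDerivAt_id (0 : ℂ)).mul (hM.mul hG).hasDerivAt
  convert! h using 1
  · ext s
    rw [Complex.one_div_Gamma_eq_self_mul_one_div_Gamma_add_one]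
    simp only [Pi.mul_apply, id]
    ring
  · simp

/-- Equations (2.41)–(2.44): the difference `Z_D = ζ_{Δ_𝕂} - ζ_{Δ_𝕋}` of the
spectral zeta functions of the Klein bottle and the flat torus extends to an
entire function `f` with `f'(0) = -2∑_{k≥1} log(1 + 2/(e^{ak/ρ}-1))`. -/
theorem stmt_15 (a ρ : ℝ) (ha : 0 < a) (hρ : 0 < ρ) :
    ∃ f : ℂ → ℂ,
      Differentiable ℂ f ∧
      (∀ s : ℂ, 1 < s.re →
        Summable (fun p : ℕ × ℕ =>
          (((4 * π ^ 2 * ((p.1 : ℝ) + 1 - 1 / 2) ^ 2 / a ^ 2 +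
              ((p.2 : ℝ) + 1) ^ 2 / ρ ^ 2 : ℝ) : ℂ)) ^ (-s)) ∧
        Summable (fun p : ℕ × ℕ =>
          (((4 * π ^ 2 * ((p.1 : ℝ) + 1) ^ 2 / a ^ 2 +
              ((p.2 : ℝ) + 1) ^ 2 / ρ ^ 2 : ℝ) : ℂ)) ^ (-s)) ∧
        Summable (fun m : ℕ => (((((m : ℝ) + 1) ^ 2 / ρ ^ 2 : ℝ) : ℂ)) ^ (-s)) ∧
        f s =
          2 * ∑' p : ℕ × ℕ,
              (((4 * π ^ 2 * ((p.1 : ℝ) + 1 - 1 / 2) ^ 2 / a ^ 2 +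
                  ((p.2 : ℝ) + 1) ^ 2 / ρ ^ 2 : ℝ) : ℂ)) ^ (-s) -
            2 * ∑' p : ℕ × ℕ,
              (((4 * π ^ 2 * ((p.1 : ℝ) + 1) ^ 2 / a ^ 2 +
                  ((p.2 : ℝ) + 1) ^ 2 / ρ ^ 2 : ℝ) : ℂ)) ^ (-s) -
            ∑' m : ℕ, (((((m : ℝ) + 1) ^ 2 / ρ ^ 2 : ℝ) : ℂ)) ^ (-s)) ∧
      Summable (fun k : ℕ =>
        Real.log (1 + 2 / (Real.exp (a * ((k : ℝ) + 1) / ρ) - 1))) ∧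
      deriv f 0 =
        ((-2 * ∑' k : ℕ,
          Real.log (1 + 2 / (Real.exp (a * ((k : ℝ) + 1) / ρ) - 1)) : ℝ) : ℂ) := by
  set u : ℝ := 4 * π ^ 2 / a ^ 2 with hu
  set v : ℝ := 1 / ρ ^ 2 with hv
  have hu0 : 0 < u := by positivity
  have hv0 : 0 < v := by positivity
  have hform : ∀ x : ℝ, 4 * π ^ 2 * x ^ 2 / a ^ 2 = u * x ^ 2 := fun x => by rw [hu]; ring
  have hform' : ∀ y : ℝ, y ^ 2 / ρ ^ 2 = v * y ^ 2 := fun y => by rw [hv]; ring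
  have hhalf : ∀ m : ℕ, (m : ℝ) + 1 - 1 / 2 = m + 1 / 2 := fun m => by ring
  have hratio : ∀ k : ℕ, a * ((k : ℝ) + 1) / ρ =
      2 * π * √(v / π / (u / π)) * ((k : ℝ) + 1) := fun k => by
    rw [show v / π / (u / π) = (a / (2 * π * ρ)) ^ 2 by rw [hu, hv]; field_simp; norm_num,
      Real.sqrt_sq (by positivity)]
    field_simp
  simp only [hform, hform', hhalf, hratio]
  have hA : 0 < v / π := by positivity
  have hB : 0 < u / π := by positivity
  have hM := differentiable_mellin_heatDiff hA hB
  have hlog := hasSum_log_integral_heatDiff hA hB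
  refine ⟨fun s => mellin (fun t => (heatDiff (v / π) (u / π) t : ℂ)) s * (Complex.Gamma s)⁻¹,
    hM.mul Complex.differentiable_one_div_Gamma, fun s hs => ⟨?_, ?_, ?_, ?_⟩, ?_, ?_⟩
  · refine Complex.summable_cpow_neg_of_one_div_rpow (fun _ => by positivity) ?_
    exact summable_one_div_quadratic_rpow hu0 hv0 (δ := 1 / 2) (by norm_num) (by norm_num) hs
  · refine Complex.summable_cpow_neg_of_one_div_rpow (fun _ => by positivity) ?_
    exact summable_one_div_quadratic_rpow hu0 hv0 one_pos le_rfl hs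
  · refine Complex.summable_cpow_neg_of_one_div_rpow (fun _ => by positivity) ?_
    exact summable_one_div_mul_sq_rpow hv0 hs
  · have hΓ : Complex.Gamma s ≠ 0 := Complex.Gamma_ne_zero_of_re_pos (by linarith)
    beta_reduce
    rw [mellin_heatDiff_eq hu0 hv0 hs, mul_comm (Complex.Gamma s), mul_inv_cancel_right₀ hΓ]
  · exact (summable_mul_left_iff (by norm_num : (-2 : ℝ) ≠ 0)).1 hlog.summable
  · rw [(Complex.hasDerivAt_mul_inv_Gamma_zero (hM 0)).deriv, mellin_heatDiff_zero,
      ← hlog.tsum_eq, tsum_mul_left]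
end
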